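/- arXiv:1407.5638 — 11 statements merged into one kernel-verified Lean document; each statement's English description precedes it below -/
import Mathlib

section
/- Let q = p^h be a prime power, let U be a nonempty set of points of AG(2,q) = GF(q)^2, let D be the set of directions determined by U, and suppose D is nonempty. Let s = min_{y∈D} s(y) and suppose s ≥ p (i.e. s > 1). Then |U| ≡ 0 (mod s) and |D| ≡ 1 (mod s). -/
open Polynomial
open scoped Classical

noncomputable section

/-- The direction determined by two points of `AG(2,q) = F × F`; `none` denotes the
vertical direction `∞`, and `some m` denotes the slope `m = (b-d)/(a-c)`. -/
def direction {F : Type*} [Field F] (P Q : F × F) : Option F :=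
  if P.1 = Q.1 then none else some ((P.2 - Q.2) / (P.1 - Q.1))

/-- The set of directions determined by a set `U` of affine points. -/
def dirSet {F : Type*} [Field F] (U : Set (F × F)) : Set (Option F) :=
  {d | ∃ P ∈ U, ∃ Q ∈ U, P ≠ Q ∧ direction P Q = d}

/-- Membership in the affine line with direction `y` and parameter `c`:
for `y = some m` the line `{(u,w) | w = m·u + c}`, for `y = none` the vertical line
`{(u,w) | u = c}`. -/
def onLine {F : Type*} [Field F] (y : Option F) (c : F) (P : F × F) : Prop :=
  match y with
  | none => P.1 = c
  | some m => P.2 = m * P.1 + c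

/-- The number of points of `U` on the affine line with direction `y` and parameter `c`. -/
def lineCount {F : Type*} [Field F] (U : Set (F × F)) (y : Option F) (c : F) : ℕ :=
  {P ∈ U | onLine y c P}.ncard

/-- `s(y)`: the gcd of the intersection sizes of `U` with the lines of direction `y`,
together with `q`. -/
def sdir {F : Type*} [Field F] [Fintype F] (U : Set (F × F)) (y : Option F) : ℕ :=
  Nat.gcd (Fintype.card F) (Finset.univ.gcd fun c : F => lineCount U y c)

/-- `s`: the minimum of `s(y)` over the determined directions. -/
def sMin {F : Type*} [Field F] [Fintype F] (U : Set (F × F)) : ℕ :=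
  sInf (sdir U '' dirSet U)

theorem exists_onLine {F : Type*} [Field F] (y : Option F) (P : F × F) :
    ∃ c, onLine y c P := by
  cases y with
  | none => exact ⟨P.1, rfl⟩
  | some m => exact ⟨P.2 - m * P.1, by simp [onLine]⟩

theorem onLine_unique {F : Type*} [Field F] (y : Option F) (P : F × F) (c d : F)
    (h1 : onLine y c P) (h2 : onLine y d P) : c = d := by
  cases y with
  | none => exact h1.symm.trans h2
  | some m =>
    simp only [onLine] at h1 h2
    linear_combination h2 - h1

theorem direction_iff {F : Type*} [Field F] (y : Option F) (c : F) (P Q : F × F)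
    (hPQ : Q ≠ P) (hP : onLine y c P) : direction P Q = y ↔ onLine y c Q := by
  cases y with
  | none =>
    simp only [onLine, direction] at *
    subst hP
    simp [eq_comm]
  | some m =>
    simp only [onLine, direction] at *
    by_cases h : P.1 = Q.1
    · simp only [h, if_true]
      constructor
      · intro h'
        cases h'
      · intro h'
        exact absurd (Prod.ext h.symm (by rw [h', hP, h])) hPQ
    · have h2 : P.1 - Q.1 ≠ 0 := sub_ne_zero.mpr h
      simp only [h, if_false, Option.some.injEq, div_eq_iff h2]
      constructor
      · intro h'
        linear_combination hP - h'
      · intro h'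
        linear_combination hP - h'

theorem sMin_dvd {F : Type*} [Field F] [Fintype F] (p h : ℕ) (hp : p.Prime)
    (hcard : Fintype.card F = p ^ h) (U : Set (F × F)) (y : Option F) (hy : y ∈ dirSet U)
    (c : F) : sMin U ∣ lineCount U y c := by
  have hmem : sMin U ∈ sdir U '' dirSet U := Nat.sInf_mem ⟨_, y, hy, rfl⟩
  have hle : sMin U ≤ sdir U y := Nat.sInf_le ⟨y, hy, rfl⟩
  obtain ⟨z, hz, hzs⟩ := hmem
  have h1 : sMin U ∣ p ^ h := by
    rw [← hzs, ← hcard]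
    exact Nat.gcd_dvd_left _ _
  have h2 : sdir U y ∣ p ^ h := by
    rw [← hcard]
    exact Nat.gcd_dvd_left _ _
  obtain ⟨a, -, ha⟩ := (Nat.dvd_prime_pow hp).1 h1
  obtain ⟨b, -, hb⟩ := (Nat.dvd_prime_pow hp).1 h2
  have h3 : sMin U ∣ sdir U y := by
    rw [ha, hb] at hle ⊢
    exact pow_dvd_pow p ((Nat.pow_le_pow_iff_right hp.one_lt).1 hle)
  exact (h3.trans (Nat.gcd_dvd_right _ _)).trans (Finset.gcd_dvd (Finset.mem_univ c))

theorem lineCount_eq {F : Type*} [Field F] [Fintype F] (U : Set (F × F)) (y : Option F) (c : F) :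
    lineCount U y c = (U.toFinset.filter (onLine y c)).card := by
  rw [lineCount, ← Set.ncard_coe_finset]
  congr 1
  ext
  simp

/-- If `q = p^h`, `U ⊆ AG(2,q)` is nonempty, its direction set `D` is
nonempty and `s = min_{y∈D} s(y)` satisfies `s ≥ p`, then `|U| ≡ 0 (mod s)` and
`|D| ≡ 1 (mod s)`. -/
theorem number_of_points_and_directions_mod_s
    {F : Type*} [Field F] [Fintype F] (p h : ℕ) (hp : p.Prime) (hh : 0 < h)
    (hcard : Fintype.card F = p ^ h) (U : Set (F × F)) (hU : U.Nonempty)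
    (hD : (dirSet U).Nonempty) (hs : p ≤ sMin U) :
    U.ncard ≡ 0 [MOD sMin U] ∧ (dirSet U).ncard ≡ 1 [MOD sMin U] := by
  obtain ⟨P, hP⟩ := hU
  obtain ⟨y₀, hy₀⟩ := hD
  have hdvd := sMin_dvd p h hp hcard U
  have e1 : U.ncard = U.toFinset.card := Set.ncard_eq_toFinset_card' U
  have e2 : (dirSet U).ncard = (dirSet U).toFinset.card := Set.ncard_eq_toFinset_card' _
  have hUd : sMin U ∣ U.ncard := by
    choose f hf using exists_onLine (F := F) y₀
    rw [e1, Finset.card_eq_sum_card_fiberwise (f := f) (t := Finset.univ) (by simp)]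
    refine Finset.dvd_sum fun c _ => ?_
    have : U.toFinset.filter (fun Q => f Q = c) = U.toFinset.filter (onLine y₀ c) := by
      refine Finset.filter_congr fun Q _ => ?_
      constructor
      · rintro rfl
        exact hf Q
      · exact fun h' => onLine_unique y₀ Q _ _ (hf Q) h'
    rw [this, ← lineCount_eq]
    exact hdvd y₀ hy₀ c
  refine ⟨(Nat.modEq_zero_iff_dvd).2 hUd, ?_⟩
  choose c hc using fun y => exists_onLine (F := F) y P
  have hPm : P ∈ U.toFinset := by simpa using hP
  have h1 : (U.toFinset.erase P).card =
      ∑ y ∈ (dirSet U).toFinset, ((U.toFinset.erase P).filter (fun Q => direction P Q = y)).card := by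
    refine Finset.card_eq_sum_card_fiberwise ?_
    intro Q hQ
    simp only [Finset.coe_erase, Set.coe_toFinset, Set.mem_diff, Set.mem_singleton_iff] at hQ ⊢
    exact ⟨P, hP, Q, hQ.1, fun e => hQ.2 e.symm, rfl⟩
  have h2 : ∀ y, ((U.toFinset.erase P).filter (fun Q => direction P Q = y)).card + 1
      = lineCount U y (c y) := by
    intro y
    rw [lineCount_eq, ← Finset.card_erase_add_one (a := P)
      (Finset.mem_filter.2 ⟨hPm, hc y⟩)]
    congr 2
    ext Q
    simp only [Finset.mem_filter, Finset.mem_erase]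
    constructor
    · rintro ⟨⟨a, b⟩, d⟩
      exact ⟨a, b, (direction_iff y (c y) P Q a (hc y)).1 d⟩
    · rintro ⟨a, b, d⟩
      exact ⟨⟨a, b⟩, (direction_iff y (c y) P Q a (hc y)).2 d⟩
  have h3 : (U.toFinset.erase P).card + (dirSet U).toFinset.card
      = ∑ y ∈ (dirSet U).toFinset, lineCount U y (c y) := by
    rw [h1, Finset.card_eq_sum_ones, ← Finset.sum_add_distrib]
    exact Finset.sum_congr rfl fun y _ => h2 y
  have h4 : sMin U ∣ (U.toFinset.erase P).card + (dirSet U).toFinset.card := by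
    rw [h3]
    exact Finset.dvd_sum fun y hy => hdvd y (by simpa using hy) _
  have h5 := Finset.card_erase_add_one hPm
  rw [← e1] at h5
  rw [← e2] at h4
  have h6 : (U.toFinset.erase P).card + (dirSet U).ncard ≡
      (U.toFinset.erase P).card + 1 [MOD sMin U] := by
    rw [h5]
    exact ((Nat.modEq_zero_iff_dvd).2 h4).trans ((Nat.modEq_zero_iff_dvd).2 hUd).symm
  exact Nat.ModEq.add_left_cancel' _ h6
end
end

section
/- (Blokhuis–Ball–Brouwer–Storme–Szőnyi; Ball.) Let q = p^h, let U ⊆ GF(q)^2 with |U| = q, let D be the set of directions determined by U, and suppose ∞ ∉ D. Let s = min_{y∈D} s(y). Then one of the following holds: (i) s = 1 and (q+3)/2 ≤ |D| ≤ q; (ii) 1 < s < q, GF(s) is a subfield of GF(q) (i.e. writing s = p^e one has e | h), and q/s + 1 ≤ |D| ≤ (q−1)/(s−1); (iii) s = q and |D| = 1. Moreover, if s > 2 then U is a GF(s)-linear affine set, i.e. a coset of a GF(s)-submodule of GF(q)^2 (with GF(s) a subfield of GF(q)). -/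
open Polynomial
open scoped Classical

noncomputable section

section BBBSS

set_option linter.unusedSectionVars false

variable {F : Type*} [Field F] [Fintype F]

/-- Number of points of the graph of `f` on the line with slope `y`, intercept `c`. -/
def cntL (f : F → F) (y c : F) : ℕ := (Finset.univ.filter fun x => f x - y * x = c).card

/-- Slopes determined by the graph of `f`. -/
def dirF (f : F → F) : Finset F :=
  Finset.univ.filter fun y => ∃ x z, x ≠ z ∧ f x - y * x = f z - y * z

/-- `s(y)` for graphs. -/
def sdF (f : F → F) (y : F) : ℕ :=
  Nat.gcd (Fintype.card F) (Finset.univ.gcd fun c : F => cntL f y c)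

/-- Rédei polynomial. -/
def Rp (f : F → F) : F[X][X] := ∏ x, (X - C (C (f x) - C x * X))

/-- Specialised Rédei polynomial. -/
def Ry (f : F → F) (y : F) : F[X] := ∏ x, (X - C (f x - y * x))

lemma coeff_aux (f : F → F) (S : Finset F) : ∀ i j, S.card ≤ i + j →
    ((∏ x ∈ S, (X - C (C (f x) - C x * X)) : F[X][X]).coeff i).coeff j =
      if i + j = S.card then (∏ x ∈ S, (X + C x) : F[X]).coeff i else 0 := by
  induction S using Finset.induction_on with
  | empty =>
    intro i j _
    simp only [Finset.prod_empty, Finset.card_empty, coeff_one]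
    by_cases hi : i = 0 <;> by_cases hj : j = 0 <;> simp [hi, hj, coeff_one]
  | insert a S ha ih =>
    intro i j hij
    rw [Finset.card_insert_of_notMem ha] at hij ⊢
    rw [Finset.prod_insert ha, Finset.prod_insert ha]
    rw [sub_mul, add_mul, coeff_sub, coeff_sub, coeff_C_mul, coeff_add, coeff_C_mul]
    have h2 : ((C (f a) - C a * X) * (∏ x ∈ S, (X - C (C (f x) - C x * X)) : F[X][X]).coeff i).coeff j
        = - (if i + j = S.card + 1 then a * (∏ x ∈ S, (X + C x) : F[X]).coeff i else 0) := by
      rw [sub_mul, coeff_sub, coeff_C_mul, mul_assoc, coeff_C_mul]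
      rw [ih i j (by omega), if_neg (by omega)]
      cases j with
      | zero =>
        rw [coeff_X_mul_zero]
        have : (∏ x ∈ S, (X + C x) : F[X]).coeff i = 0 := by
          apply coeff_eq_zero_of_natDegree_lt
          refine lt_of_le_of_lt (natDegree_prod_le _ _) ?_
          simp; omega
        simp [this]
      | succ j =>
        rw [coeff_X_mul, ih i j (by omega)]
        by_cases h : i + j = S.card
        · rw [if_pos h, if_pos (by omega)]; simp
        · rw [if_neg h, if_neg (by omega)]; simp
    rw [h2]
    cases i with
    | zero =>
      simp
    | succ i =>
      rw [coeff_X_mul, coeff_X_mul, ih i j (by omega)]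
      by_cases h : i + j = S.card
      · rw [if_pos h, if_pos (by omega), if_pos (by omega)]; simp
      · rw [if_neg h, if_neg (by omega), if_neg (by omega)]; simp

lemma two_le_card : 2 ≤ Fintype.card F := Fintype.one_lt_card

lemma prod_X_sub_C_univ : (∏ x : F, (X - C x) : F[X]) = X ^ Fintype.card F - X := by
  have h1 := FiniteField.roots_X_pow_card_sub_X F
  have hm : (X ^ Fintype.card F - X : F[X]).Monic :=
    monic_X_pow_sub (by rw [degree_X]; exact_mod_cast Fintype.one_lt_card)
  have h2 := prod_multiset_X_sub_C_of_monic_of_roots_card_eq hm (by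
    rw [h1, FiniteField.X_pow_card_sub_X_natDegree_eq F Fintype.one_lt_card]; rfl)
  rw [h1] at h2
  exact h2

lemma prod_X_add_C : (∏ x : F, (X + C x) : F[X]) = X ^ Fintype.card F - X := by
  rw [← prod_X_sub_C_univ]
  rw [← Equiv.prod_comp (Equiv.neg F)]
  simp [sub_eq_add_neg]

lemma eval_Rp (f : F → F) (y : F) (i : ℕ) :
    eval y ((Rp f).coeff i) = (Ry f y).coeff i := by
  have : (Rp f).map (evalRingHom y) = Ry f y := by
    rw [Rp, Ry, Polynomial.map_prod]
    refine Finset.prod_congr rfl fun x _ => ?_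
    rw [mul_comm y x]; simp
  rw [← this, coeff_map]; rfl

lemma natDegree_Rp_coeff (f : F → F) (i : ℕ) (hi : 1 < i) (hiq : i < Fintype.card F) :
    ((Rp f).coeff i).natDegree < Fintype.card F - i := by
  rw [Nat.lt_iff_le_pred (by omega), natDegree_le_iff_coeff_eq_zero]
  intro j hj
  rw [Rp, coeff_aux f Finset.univ i j (by rw [Finset.card_univ]; omega), prod_X_add_C]
  simp [coeff_X_pow, coeff_X, hiq.ne, hi.ne]

lemma Ry_of_notMem (f : F → F) (y : F) (hy : y ∉ dirF f) :
    Ry f y = X ^ Fintype.card F - X := by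
  have hinj : Function.Injective (fun x => f x - y * x) := by
    intro a b hab
    by_contra hne
    exact hy (by simp only [dirF, Finset.mem_filter, Finset.mem_univ, true_and]; exact ⟨a, b, hne, hab⟩)
  have hbij := Finite.injective_iff_bijective.mp hinj
  rw [← prod_X_sub_C_univ, Ry]
  exact (Equiv.prod_comp (Equiv.ofBijective _ hbij) (fun c => (X - C c : F[X])))

lemma Ry_monic (f : F → F) (y : F) : (Ry f y).Monic := monic_prod_X_sub_C _ _

lemma Ry_natDegree (f : F → F) (y : F) : (Ry f y).natDegree = Fintype.card F := by
  rw [Ry, natDegree_prod_of_monic _ _ (fun i _ => monic_X_sub_C _)]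
  simp only [natDegree_X_sub_C]; simp

lemma Rp_coeff_zero (f : F → F) (i : ℕ) (hi : 1 < i) (hiq : i < Fintype.card F)
    (hN : (dirF f).card ≤ i) : (Rp f).coeff i = 0 := by
  have hle : (dirF f).card ≤ Fintype.card F := Finset.card_le_univ _
  apply eq_zero_of_natDegree_lt_card_of_eval_eq_zero' _ (dirF f)ᶜ
  · intro y hy
    rw [eval_Rp, Ry_of_notMem f y (by simpa using hy)]
    simp [coeff_X_pow, coeff_X, hiq.ne, hi.ne]
  · rw [Finset.card_compl]
    have := natDegree_Rp_coeff f i hi hiq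
    omega

lemma Ry_coeff_zero (f : F → F) (y : F) (i : ℕ) (hi : 1 < i) (hiq : i < Fintype.card F)
    (hN : (dirF f).card ≤ i) : (Ry f y).coeff i = 0 := by
  rw [← eval_Rp, Rp_coeff_zero f i hi hiq hN, eval_zero]

/-- `X + g` has small degree. -/
lemma natDegree_g (f : F → F) (y : F) :
    (Ry f y - X ^ Fintype.card F).natDegree < max (dirF f).card 2 := by
  have h2 := two_le_card (F := F)
  rw [Nat.lt_iff_le_pred (by simp), natDegree_le_iff_coeff_eq_zero]
  intro i hi
  rw [coeff_sub, coeff_X_pow]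
  rcases lt_trichotomy i (Fintype.card F) with h | h | h
  · rw [Ry_coeff_zero f y i (by omega) h (by omega), if_neg h.ne, sub_zero]
  · have := (Ry_monic f y).coeff_natDegree
    rw [Ry_natDegree] at this
    simp [h, this]
  · rw [coeff_eq_zero_of_natDegree_lt (by rw [Ry_natDegree]; exact h), if_neg h.ne', sub_zero]


lemma Ry_eq_prod (f : F → F) (y : F) : Ry f y = ∏ c, (X - C c) ^ cntL f y c := by
  rw [Ry, ← Finset.prod_fiberwise Finset.univ (fun x => f x - y * x)]
  refine Finset.prod_congr rfl fun c _ => ?_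
  rw [cntL, Finset.prod_congr rfl (g := fun _ => (X - C c : F[X])), Finset.prod_const]
  intro x hx
  rw [(Finset.mem_filter.mp hx).2]

lemma sum_cntL (f : F → F) (y : F) : ∑ c, cntL f y c = Fintype.card F := by
  have := Finset.card_eq_sum_card_fiberwise (s := (Finset.univ : Finset F)) (t := Finset.univ)
    (f := fun x => f x - y * x) (by simp)
  rw [Finset.card_univ] at this
  exact this.symm

lemma coprime_pows (m : F → ℕ) : Pairwise (Function.onFun IsCoprime fun c : F => (X - C c : F[X]) ^ m c) := by
  intro a b hab
  exact (isCoprime_X_sub_C_of_isUnit_sub (sub_ne_zero.mpr hab).isUnit).pow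

lemma eval_gX (f : F → F) (y c : F) (hc : cntL f y c ≠ 0) :
    eval c (Ry f y - X ^ Fintype.card F + X) = 0 := by
  have : eval c (Ry f y) = 0 := by
    rw [Ry_eq_prod, eval_prod]
    exact Finset.prod_eq_zero (Finset.mem_univ c) (by simp [hc])
  simp [this, FiniteField.pow_card]

lemma gX_ne_zero (f : F → F) (y : F) (hy : y ∈ dirF f) :
    Ry f y - X ^ Fintype.card F + X ≠ 0 := by
  intro h0
  have h1 : Ry f y = X ^ Fintype.card F - X := by linear_combination h0
  obtain ⟨x, x', hne, he⟩ := (Finset.mem_filter.mp hy).2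
  have h2 : (X - C (f x - y * x)) ^ 2 ∣ Ry f y := by
    have : 2 ≤ cntL f y (f x - y * x) := by
      rw [cntL]
      exact Finset.one_lt_card.mpr ⟨x, by simp, x', by simp [he], hne⟩
    rw [Ry_eq_prod]
    exact (pow_dvd_pow _ this).trans (Finset.dvd_prod_of_mem _ (Finset.mem_univ _))
  have h3 : (X - C (f x - y * x)) ∣ derivative (Ry f y) := by
    simpa using pow_sub_one_dvd_derivative_of_pow_dvd h2
  rw [h1] at h3
  have : derivative (X ^ Fintype.card F - X : F[X]) = -1 := by
    simp [derivative_X_pow]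
  rw [this] at h3
  exact (not_isUnit_X_sub_C _) (isUnit_of_dvd_unit h3 (by simp))

/-- The Rédei-type bound. -/
lemma redei_bound (f : F → F) (y : F) (hy : y ∈ dirF f) (hd : derivative (Ry f y) ≠ 0) :
    Fintype.card F + 3 ≤ 2 * (dirF f).card := by
  set g := Ry f y - X ^ Fintype.card F with hg
  have hdvd : Ry f y ∣ (g + X) * derivative (Ry f y) := by
    conv_lhs => rw [Ry_eq_prod]
    apply Fintype.prod_dvd_of_coprime (coprime_pows _)
    intro c
    by_cases hc : cntL f y c = 0
    · simp [hc]
    · have h1 : (X - C c) ∣ g + X := dvd_iff_isRoot.mpr (eval_gX f y c hc)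
      have h2 : (X - C c) ^ cntL f y c ∣ Ry f y := by
        rw [Ry_eq_prod]; exact Finset.dvd_prod_of_mem _ (Finset.mem_univ c)
      have h3 := pow_sub_one_dvd_derivative_of_pow_dvd h2
      obtain ⟨m, hm⟩ := Nat.exists_eq_succ_of_ne_zero hc
      rw [hm, pow_succ'] 
      rw [hm] at h3
      exact mul_dvd_mul h1 h3
  have hgd : derivative (Ry f y) = derivative g := by
    simp [hg, derivative_X_pow]
  have hne : g + X ≠ 0 := gX_ne_zero f y hy
  have h1 := natDegree_le_of_dvd hdvd (mul_ne_zero hne hd)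
  rw [Ry_natDegree, natDegree_mul hne hd] at h1
  have h2 := natDegree_g f y
  have h3 : (g + X).natDegree ≤ max g.natDegree 1 := by
    simpa using natDegree_add_le g X
  have h4 : (derivative g).natDegree ≤ g.natDegree - 1 := natDegree_derivative_le g
  rw [hgd] at h1
  have h5 := two_le_card (F := F)
  rw [← hg] at h2
  omega

lemma dvd_cnt_of_derivative (p : ℕ) [CharP F p] (f : F → F) (y : F)
    (hd : derivative (Ry f y) = 0) (c : F) : p ∣ cntL f y c := by
  by_cases hc : cntL f y c = 0
  · simp [hc]
  obtain ⟨m, hm⟩ := Nat.exists_eq_succ_of_ne_zero hc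
  set K : F[X] := ∏ c' ∈ Finset.univ.erase c, (X - C c') ^ cntL f y c' with hK
  have hR : Ry f y = (X - C c) ^ (m + 1) * K := by
    rw [Ry_eq_prod, ← Finset.mul_prod_erase _ _ (Finset.mem_univ c), hm]
  have hKc : eval c K ≠ 0 := by
    rw [hK, eval_prod]
    refine Finset.prod_ne_zero_iff.mpr fun c' hc' => ?_
    simp only [eval_pow, eval_sub, eval_X, eval_C]
    exact pow_ne_zero _ (sub_ne_zero.mpr (Finset.ne_of_mem_erase hc').symm)
  rw [hR, derivative_mul, derivative_X_sub_C_pow] at hd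
  have h2 : (X - C c) ^ m * (C ((m + 1 : ℕ) : F) * K + (X - C c) * derivative K) = 0 := by
    rw [← hd]
    simp only [Nat.add_sub_cancel]
    ring
  have h3 := (mul_eq_zero.mp h2).resolve_left (pow_ne_zero _ (X_sub_C_ne_zero c))
  have h4 := congrArg (eval c) h3
  simp only [eval_add, eval_mul, eval_C, eval_sub, eval_X, sub_self, zero_mul, add_zero,
    eval_zero] at h4
  rw [hm]
  exact (CharP.cast_eq_zero_iff F p _).mp ((mul_eq_zero.mp h4).resolve_right hKc)

lemma derivative_of_dvd_cnt (p : ℕ) [CharP F p] (f : F → F) (y : F)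
    (h : ∀ c, p ∣ cntL f y c) : derivative (Ry f y) = 0 := by
  choose k hk using h
  have : Ry f y = (∏ c, (X - C c) ^ k c) ^ p := by
    rw [Ry_eq_prod, ← Finset.prod_pow]
    refine Finset.prod_congr rfl fun c _ => ?_
    rw [hk, mul_comm, pow_mul]
  rw [this, derivative_pow]
  simp

lemma Rp_natDegree_le (f : F → F) : (Rp f).natDegree ≤ Fintype.card F := by
  rw [Rp, natDegree_prod_of_monic _ _ (fun i _ => monic_X_sub_C _)]
  simp only [natDegree_X_sub_C]; simp

lemma Rp_derivative (p : ℕ) (hp : p.Prime) [CharP F p] (f : F → F)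
    (h : ∀ y ∈ dirF f, ∀ c, p ∣ cntL f y c) :
    derivative (Rp f) = C ((Rp f).coeff 1) := by
  have hq0 : ((Fintype.card F : ℕ) : F[X]) = 0 := by
    rw [← C_eq_natCast]; simp
  ext1 n
  rw [coeff_derivative, coeff_C]
  cases n with
  | zero => simp
  | succ n =>
    rw [if_neg (by simp)]
    have hcast : (((n + 1 : ℕ) : F[X]) + 1) = ((n + 2 : ℕ) : F[X]) := by push_cast; ring
    rw [hcast]
    rcases lt_trichotomy (n + 2) (Fintype.card F) with hn | hn | hn
    · by_cases hpn : p ∣ n + 2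
      · rw [(CharP.cast_eq_zero_iff F[X] p _).mpr hpn, mul_zero]
      · have : (Rp f).coeff (n + 2) = 0 := by
          apply eq_zero_of_natDegree_lt_card_of_eval_eq_zero' _ Finset.univ
          · intro y _
            rw [eval_Rp]
            by_cases hy : y ∈ dirF f
            · have h1 := congrArg (fun P => coeff P (n + 1))
                (derivative_of_dvd_cnt p f y (h y hy))
              simp only [coeff_derivative, coeff_zero] at h1
              refine (mul_eq_zero.mp h1).resolve_right fun h2 => hpn ?_
              rw [← CharP.cast_eq_zero_iff F p]
              rw [← h2]; push_cast; ring
            · rw [Ry_of_notMem f y hy]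
              simp [coeff_X_pow, coeff_X, hn.ne]
          · have := natDegree_Rp_coeff f (n + 2) (by omega) hn
            rw [Finset.card_univ]; omega
        rw [this, zero_mul]
    · rw [hn, hq0, mul_zero]
    · rw [coeff_eq_zero_of_natDegree_lt (lt_of_le_of_lt (Rp_natDegree_le f) hn), zero_mul]

lemma count_roots_lin (S : Finset F) (u v : F → F) (hu : ∀ x ∈ S, u x ≠ 0) (y : F) :
    (∏ x ∈ S, (C (u x) * X - C (v x))).roots.count y = (S.filter fun x => u x * y = v x).card := by
  have hne : ∀ x ∈ S, (C (u x) * X - C (v x)) ≠ 0 := by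
    intro x hx h0
    have := congrArg (fun P => coeff P 1) h0
    simp [coeff_C] at this
    exact hu x hx this
  rw [roots_prod _ _ (Finset.prod_ne_zero_iff.mpr hne), Multiset.count_bind,
    Finset.card_filter]
  change (∑ x ∈ S, _) = _
  refine Finset.sum_congr rfl fun x hx => ?_
  rw [roots_C_mul_X_sub_C _ (hu x hx), Multiset.count_singleton]
  have h1 := hu x hx
  congr 1
  rw [eq_iff_iff, eq_inv_mul_iff_mul_eq₀ h1]

lemma Rp_coeff_one (p : ℕ) (hp : p.Prime) [CharP F p] (f : F → F)
    (h : ∀ y ∈ dirF f, ∀ c, p ∣ cntL f y c) (a : F) :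
    (Rp f).coeff 1 = ∏ x ∈ Finset.univ.erase a, (C (x - a) * X - C (f x - f a)) := by
  have h1 := congrArg (eval (C (f a) - C a * X)) (Rp_derivative p hp f h)
  rw [eval_C] at h1
  rw [← h1, Rp, ← Finset.mul_prod_erase _ _ (Finset.mem_univ a), derivative_mul]
  simp only [derivative_X_sub_C, one_mul, eval_add, eval_mul, eval_sub, eval_X, eval_C, sub_self,
    zero_mul, add_zero]
  rw [eval_prod]
  refine Finset.prod_congr rfl fun x _ => ?_
  simp only [eval_sub, eval_X, eval_C, C_sub]
  ring

lemma cnt_succ (f : F → F) (y a : F) : cntL f y (f a - y * a) =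
    ((Finset.univ.erase a).filter fun x => f x - y * x = f a - y * a).card + 1 := by
  rw [cntL, ← Finset.card_erase_add_one (a := a) (by simp), Finset.filter_erase]

lemma cnt_const (p : ℕ) (hp : p.Prime) [CharP F p] (f : F → F)
    (h : ∀ y ∈ dirF f, ∀ c, p ∣ cntL f y c) (y a : F) :
    cntL f y (f a - y * a) = ((Rp f).coeff 1).roots.count y + 1 := by
  rw [Rp_coeff_one p hp f h a, cnt_succ, count_roots_lin]
  · congr 2
    ext x
    simp only [Finset.mem_filter, and_congr_right_iff]
    intro _
    constructor <;> intro h' <;> linear_combination -h'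
  · intro x hx
    exact sub_ne_zero.mpr (Finset.ne_of_mem_erase hx)

lemma cnt_eq_sdF (p : ℕ) (hp : p.Prime) [CharP F p] (f : F → F)
    (h : ∀ y ∈ dirF f, ∀ c, p ∣ cntL f y c) (y a : F) :
    cntL f y (f a - y * a) = sdF f y := by
  set m := ((Rp f).coeff 1).roots.count y + 1 with hm
  have h1 : ∀ c, m ∣ cntL f y c := by
    intro c
    by_cases hc : cntL f y c = 0
    · simp [hc]
    · obtain ⟨x, hx⟩ := Finset.card_ne_zero.mp hc
      rw [← (Finset.mem_filter.mp hx).2, cnt_const p hp f h]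
  have h2 : m ∣ Fintype.card F := by
    rw [← sum_cntL f y]; exact Finset.dvd_sum fun c _ => h1 c
  rw [cnt_const p hp f h]
  apply Nat.dvd_antisymm
  · exact Nat.dvd_gcd h2 (Finset.dvd_gcd fun c _ => h1 c)
  · refine (Nat.gcd_dvd_right _ _).trans ?_
    refine (Finset.gcd_dvd (Finset.mem_univ (f 0 - y * 0))).trans ?_
    rw [cnt_const p hp f h]

lemma sum_slopes (f : F → F) (a b : F) :
    ∑ y, ((Finset.univ.erase a).filter fun x => f x - y * x = b - y * a).card
      = Fintype.card F - 1 := by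
  have h := Finset.card_eq_sum_card_fiberwise (s := (Finset.univ : Finset F).erase a)
    (t := Finset.univ) (f := fun x => (f x - b) / (x - a)) (by simp)
  rw [Finset.card_erase_of_mem (Finset.mem_univ a), Finset.card_univ] at h
  rw [h]
  refine Finset.sum_congr rfl fun y _ => ?_
  congr 1
  ext x
  simp only [Finset.mem_filter, and_congr_right_iff]
  intro hx
  rw [div_eq_iff (sub_ne_zero.mpr (Finset.ne_of_mem_erase hx))]
  constructor <;> intro h' <;> linear_combination h'

lemma sum_sdF (p : ℕ) (hp : p.Prime) [CharP F p] (f : F → F)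
    (h : ∀ y ∈ dirF f, ∀ c, p ∣ cntL f y c) :
    ∑ y ∈ dirF f, (sdF f y - 1) = Fintype.card F - 1 := by
  rw [← sum_slopes f 0 (f 0), ← Finset.sum_subset (Finset.subset_univ (dirF f))]
  · refine Finset.sum_congr rfl fun y _ => ?_
    rw [← cnt_eq_sdF p hp f h y 0, cnt_succ]; simp
  · intro y _ hy
    rw [Finset.card_eq_zero, Finset.filter_eq_empty_iff]
    intro x hx he
    apply hy
    simp only [dirF, Finset.mem_filter, Finset.mem_univ, true_and]
    exact ⟨x, 0, Finset.ne_of_mem_erase hx, he⟩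

/-- The product of the distinct linear factors of `Ry f y`. -/
def hP (f : F → F) (y : F) : F[X] :=
  ∏ c ∈ Finset.univ.filter (fun c => cntL f y c ≠ 0), (X - C c)

lemma hP_monic (f : F → F) (y : F) : (hP f y).Monic := monic_prod_X_sub_C _ _

lemma hP_natDegree (f : F → F) (y : F) :
    (hP f y).natDegree = (Finset.univ.filter (fun c => cntL f y c ≠ 0)).card := by
  rw [hP, natDegree_prod_of_monic _ _ (fun i _ => monic_X_sub_C _)]
  simp only [natDegree_X_sub_C]; simp

lemma hP_pow (p : ℕ) (hp : p.Prime) [CharP F p] (f : F → F)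
    (h : ∀ y ∈ dirF f, ∀ c, p ∣ cntL f y c) (y : F) :
    Ry f y = hP f y ^ sdF f y := by
  rw [Ry_eq_prod, hP, ← Finset.prod_pow, Finset.prod_filter]
  refine Finset.prod_congr rfl fun c _ => ?_
  split_ifs with hc
  · obtain ⟨x, hx⟩ := Finset.card_ne_zero.mp hc
    rw [← cnt_eq_sdF p hp f h y x, (Finset.mem_filter.mp hx).2]
  · simp [not_not.mp hc]

lemma hP_dvd (f : F → F) (y : F) : hP f y ∣ Ry f y - X ^ Fintype.card F + X := by
  apply Finset.prod_dvd_of_coprime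
  · intro a _ b _ hab
    exact isCoprime_X_sub_C_of_isUnit_sub (sub_ne_zero.mpr hab).isUnit
  · intro c hc
    exact dvd_iff_isRoot.mpr (eval_gX f y c (Finset.mem_filter.mp hc).2)

lemma hP_card (p : ℕ) (hp : p.Prime) [CharP F p] (f : F → F)
    (h : ∀ y ∈ dirF f, ∀ c, p ∣ cntL f y c) (y : F) :
    sdF f y * (hP f y).natDegree = Fintype.card F := by
  rw [← Ry_natDegree f y, hP_pow p hp f h y, natDegree_pow]

lemma lower_bound (p : ℕ) (hp : p.Prime) [CharP F p] (f : F → F)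
    (h : ∀ y ∈ dirF f, ∀ c, p ∣ cntL f y c) (y : F) (hy : y ∈ dirF f)
    (hs : sdF f y < Fintype.card F) : (hP f y).natDegree + 1 ≤ (dirF f).card := by
  have h1 := natDegree_le_of_dvd (hP_dvd f y) (gX_ne_zero f y hy)
  have h2 := natDegree_g f y
  have h3 : (Ry f y - X ^ Fintype.card F + X).natDegree ≤
      max (Ry f y - X ^ Fintype.card F).natDegree 1 := by
    refine (natDegree_add_le (Ry f y - X ^ Fintype.card F) X).trans ?_
    rw [natDegree_X]
  have h4 := hP_card p hp f h y
  have h5 : 2 ≤ (hP f y).natDegree := by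
    by_contra hlt
    have h6 := two_le_card (F := F)
    interval_cases (hP f y).natDegree <;> omega
  omega

lemma key_poly (p n e : ℕ) (hp : p.Prime) [CharP F p] (hcard : Fintype.card F = p ^ n)
    (f : F → F) (h : ∀ y ∈ dirF f, ∀ c, p ∣ cntL f y c) (y : F) (hy : y ∈ dirF f)
    (hse : sdF f y = p ^ e) (hs2 : 2 < sdF f y)
    (hN : (sdF f y - 1) * (dirF f).card ≤ Fintype.card F - 1) :
    ∃ κ : F, κ ≠ 0 ∧ hP f y ^ sdF f y - C κ * hP f y = X ^ Fintype.card F - X := by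
  have : Fact p.Prime := ⟨hp⟩
  have hmul := hP_card p hp f h y
  have hpow := hP_pow p hp f h y
  have hq2 := two_le_card (F := F)
  set s := sdF f y with hs
  set Q := (hP f y).natDegree with hQ
  set g1 := hP f y - X ^ Q with hg1
  have hg : g1 ^ s = Ry f y - X ^ Fintype.card F := by
    rw [hg1, hse, sub_pow_char_pow, ← hse, ← hpow, ← pow_mul, mul_comm Q, hmul]
  obtain ⟨k, hk⟩ := hP_dvd f y
  have hne := gX_ne_zero f y hy
  -- it suffices that `k` is a nonzero constant
  have suff : (∃ κ : F, κ ≠ 0 ∧ k = C κ) → ∃ κ : F, κ ≠ 0 ∧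
      hP f y ^ s - C κ * hP f y = X ^ Fintype.card F - X := by
    rintro ⟨κ, h0, rfl⟩
    refine ⟨κ, h0, ?_⟩
    rw [← hpow]
    linear_combination hk
  apply suff
  have hk0 : k ≠ 0 := by
    rintro rfl; exact hne (by rw [hk, mul_zero])
  have hQpos : 0 < Q := by
    rcases Nat.eq_zero_or_pos Q with h0 | h0
    · rw [h0] at hmul; omega
    · exact h0
  have hdeg := congrArg natDegree hk
  rw [(hP_monic f y).natDegree_mul' hk0, ← hQ, ← hg] at hdeg
  have hsd : (g1 ^ s).natDegree = s * g1.natDegree := natDegree_pow _ _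
  have h3 : (g1 ^ s + X).natDegree ≤ max (s * g1.natDegree) 1 := by
    rw [← hsd]
    simpa using natDegree_add_le (g1 ^ s) X
  rw [hdeg] at h3
  rcases Nat.lt_or_ge 1 Q with hQ1 | hQ1
  swap
  · -- `s = q`
    have hQe : Q = 1 := by omega
    have hg1d : g1.natDegree = 0 := by
      have : g1.degree < (hP f y).degree := by
        apply degree_sub_lt_left
        · rw [degree_X_pow, degree_eq_natDegree (hP_monic f y).ne_zero]
        · exact (hP_monic f y).ne_zero
        · rw [(hP_monic f y).leadingCoeff]; simp
      by_cases h0 : g1 = 0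
      · simp [h0]
      have := natDegree_lt_natDegree h0 this
      omega
    rw [hg1d] at h3
    have hkd : k.natDegree = 0 := by omega
    rw [natDegree_eq_zero] at hkd
    obtain ⟨κ, rfl⟩ := hkd
    exact ⟨κ, fun h0 => hk0 (by simp [h0]), rfl⟩
  · -- main case
    have hlow := lower_bound p hp f h y hy (by rw [← hs]; nlinarith)
    rw [← hQ] at hlow
    have hgd := natDegree_g f y
    rw [← hg, hsd] at hgd
    have hpQ : ((Q : ℕ) : F) = 0 := by
      rw [CharP.cast_eq_zero_iff F p]
      have : Q ∣ p ^ n := by rw [← hcard, ← hmul]; exact dvd_mul_left _ _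
      obtain ⟨i, _, hi⟩ := (Nat.dvd_prime_pow hp).mp this
      rw [hi]
      apply dvd_pow_self
      rintro rfl
      simp at hi; omega
    have hcs : ((s : ℕ) : F) = 0 := by
      rw [CharP.cast_eq_zero_iff F p, hse]
      apply dvd_pow_self
      rintro rfl
      rw [pow_zero] at hse; omega
    have hder : derivative (hP f y) = derivative g1 := by
      rw [hg1, derivative_sub, derivative_X_pow, hpQ]; simp
    have hd1 : derivative (hP f y) * k + hP f y * derivative k = 1 := by
      rw [← derivative_mul, ← hk, ← hg, derivative_add, derivative_pow, hcs]; simp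
    have hdle : (derivative g1).natDegree ≤ g1.natDegree - 1 := natDegree_derivative_le g1
    have hk' : derivative k = 0 := by
      by_contra hk'
      have e1 : hP f y * derivative k = 1 - derivative (hP f y) * k := by
        linear_combination hd1
      have e2 : Q ≤ (hP f y * derivative k).natDegree := by
        rw [(hP_monic f y).natDegree_mul' hk']; omega
      have e3 : (1 - derivative (hP f y) * k).natDegree ≤
          max 0 ((g1.natDegree - 1) + k.natDegree) := by
        refine (natDegree_sub_le _ _).trans ?_
        rw [natDegree_one]
        refine max_le_max le_rfl (natDegree_mul_le.trans ?_)
        rw [hder]; omega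
      rw [← e1] at e3
      have hNle : (s - 1) * (dirF f).card + 1 ≤ s * Q := by omega
      obtain ⟨t, ht⟩ : ∃ t, s = t + 3 := ⟨s - 3, by omega⟩
      rw [ht] at hNle hgd h3
      have e4 : t + 3 - 1 = t + 2 := by omega
      rw [e4] at hNle
      set d := g1.natDegree
      set N := (dirF f).card
      set kk := k.natDegree
      rcases Nat.eq_zero_or_pos d with hd0 | hd0
      · rw [hd0] at h3; simp at h3; omega
      have f1 : Q + kk ≤ (t + 3) * d := by
        have : 1 ≤ (t + 3) * d := by nlinarith
        omega
      have f2 : (t + 3) * d + 1 ≤ N := by omega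
      have f3 : 2 * Q + 1 ≤ d + (t + 3) * d := by omega
      nlinarith
    rw [hk', mul_zero, add_zero] at hd1
    have hu : IsUnit k := IsUnit.of_mul_eq_one_right _ hd1
    obtain ⟨κ, hκ, rfl⟩ := Polynomial.isUnit_iff.mp hu
    exact ⟨κ, hκ.ne_zero, rfl⟩

lemma const_of_pow_eq (s : ℕ) (hs : 1 < s) (κ : F) (G : F[X]) (h : G ^ s = C κ * G) :
    ∃ a, G = C a := by
  have h1 : (G ^ s).natDegree ≤ G.natDegree := by rw [h]; exact natDegree_C_mul_le _ _
  rw [natDegree_pow] at h1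
  have : G.natDegree = 0 := by nlinarith
  rw [natDegree_eq_zero] at this
  obtain ⟨a, rfl⟩ := this
  exact ⟨a, rfl⟩

/-- zeros of `H` with `H^s - κ H = X^q - X`, `H(0)=0` are closed under addition -/
lemma zeros_add (p n e : ℕ) (hp : p.Prime) [CharP F p] (hcard : Fintype.card F = p ^ n)
    (he : 1 < p ^ e) (κ : F) (H : F[X]) (h0 : eval 0 H = 0)
    (hH : H ^ p ^ e - C κ * H = X ^ Fintype.card F - X) (u v : F)
    (hu : eval u H = 0) (hv : eval v H = 0) : eval (u + v) H = 0 := by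
  have : Fact p.Prime := ⟨hp⟩
  have h1 := congrArg (fun P => P.comp (X + C u)) hH
  simp only [sub_comp, pow_comp, mul_comp, C_comp, X_comp] at h1
  rw [hcard, add_pow_char_pow, ← C_pow, ← hcard, FiniteField.pow_card] at h1
  obtain ⟨a, ha⟩ := const_of_pow_eq (p ^ e) he κ (H.comp (X + C u) - H) (by
    rw [sub_pow_char_pow]
    linear_combination h1 - hH)
  have h2 := congrArg (eval 0) ha
  simp [eval_comp, hu, h0] at h2
  have h3 := congrArg (eval v) ha
  simp [eval_comp, ← h2, hv] at h3
  rw [add_comm]; exact h3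

lemma zeros_smul (p n e : ℕ) (hp : p.Prime) [CharP F p] (hcard : Fintype.card F = p ^ n)
    (he : 1 < p ^ e) (κ : F) (H : F[X]) (h0 : eval 0 H = 0)
    (hH : H ^ p ^ e - C κ * H = X ^ Fintype.card F - X) (l u : F) (hl : l ^ p ^ e = l)
    (hu : eval u H = 0) : eval (l * u) H = 0 := by
  have : Fact p.Prime := ⟨hp⟩
  have h1 := congrArg (fun P => P.comp (C l * X)) hH
  simp only [sub_comp, pow_comp, mul_comp, C_comp, X_comp] at h1
  rw [mul_pow (C l) X, ← C_pow, FiniteField.pow_card] at h1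
  obtain ⟨a, ha⟩ := const_of_pow_eq (p ^ e) he κ (H.comp (C l * X) - C l * H) (by
    rw [sub_pow_char_pow, mul_pow, ← C_pow, hl]
    linear_combination h1 - C l * hH)
  have h2 := congrArg (eval 0) ha
  simp [eval_comp, h0] at h2
  have h3 := congrArg (eval u) ha
  simp [eval_comp, ← h2, hu] at h3
  exact h3

lemma coeff_pow_char (p e : ℕ) (hp : p.Prime) [CharP F p] (H : F[X]) (i : ℕ) :
    (H ^ p ^ e).coeff i = if p ^ e ∣ i then (H.coeff (i / p ^ e)) ^ p ^ e else 0 := by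
  have : Fact p.Prime := ⟨hp⟩
  have : ExpChar F p := ExpChar.prime hp
  rw [← map_iterateFrobenius_expand p H e, coeff_map, coeff_expand (pow_pos hp.pos e)]
  split_ifs
  · rw [iterateFrobenius_def]
  · simp

lemma e_dvd (p n e : ℕ) (hp : p.Prime) [CharP F p] (hcard : Fintype.card F = p ^ n)
    (he : 0 < e) (κ : F) (hκ : κ ≠ 0) (H : F[X]) (hd : H.natDegree < Fintype.card F)
    (hH : H ^ p ^ e - C κ * H = X ^ Fintype.card F - X) : e ∣ n := by
  by_contra hnd
  set r := n % e with hr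
  have hr0 : 0 < r := Nat.pos_of_ne_zero fun h0 => hnd (Nat.dvd_of_mod_eq_zero h0)
  have hre : r < e := Nat.mod_lt _ he
  have hn : n = r + e * (n / e) := (Nat.mod_add_div n e).symm
  have hco : ∀ i, (H ^ p ^ e).coeff i - κ * H.coeff i =
      (if i = p ^ n then 1 else 0) - (if 1 = i then 1 else 0) := by
    intro i
    have := congrArg (fun P => coeff P i) hH
    simpa [coeff_X_pow, coeff_X, hcard] using this
  have base : ∀ i, (H ^ p ^ e).coeff (p ^ (r + e * i)) = 0 →
      r + e * i < n → H.coeff (p ^ (r + e * i)) = 0 := by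
    intro i h1 h2
    have h3 := hco (p ^ (r + e * i))
    rw [h1, if_neg (Nat.pow_lt_pow_right hp.one_lt h2).ne,
      if_neg (Nat.one_lt_pow (by omega) hp.one_lt).ne] at h3
    simp at h3
    exact h3.resolve_left hκ
  have key : ∀ i, r + e * i ≤ n → (H ^ p ^ e).coeff (p ^ (r + e * i)) = 0 := by
    intro i
    induction i with
    | zero =>
      intro _
      rw [coeff_pow_char p e hp, if_neg]
      rw [Nat.pow_dvd_pow_iff_le_right hp.one_lt]
      omega
    | succ i ih =>
      intro hlt
      rw [mul_add, mul_one] at hlt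
      have := base i (ih (by omega)) (by omega)
      rw [coeff_pow_char p e hp, mul_add, mul_one, ← add_assoc, pow_add,
        Nat.mul_div_cancel _ (pow_pos hp.pos e), this]
      simp [hp.ne_zero]
  have h1 := key (n / e) hn.ge
  rw [← hn] at h1
  have h2 := hco (p ^ n)
  have hn0 : n ≠ 0 := by omega
  rw [h1, coeff_eq_zero_of_natDegree_lt (hcard ▸ hd), if_pos rfl,
    if_neg (Nat.one_lt_pow hn0 hp.one_lt).ne] at h2
  simp at h2

lemma exists_subfield (p n e : ℕ) (hp : p.Prime) [CharP F p] (hcard : Fintype.card F = p ^ n)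
    (he : 0 < e) (hen : e ∣ n) :
    ∃ K : Subfield F, Nat.card K = p ^ e ∧ ∀ l ∈ K, l ^ p ^ e = l := by
  have : Fact p.Prime := ⟨hp⟩
  have : ExpChar F p := ExpChar.prime hp
  refine ⟨(iterateFrobenius F p e).eqLocusField (RingHom.id F), ?_, fun l hl => ?_⟩
  · set P : F[X] := X ^ p ^ e - X with hP
    have h1 : 1 < p ^ e := Nat.one_lt_pow he.ne' hp.one_lt
    have hsep : P.Separable := galois_poly_separable p _ (dvd_pow_self p he.ne')
    have hspl : P.Splits := by
      apply Splits.of_dvd (g := X ^ Fintype.card F - X)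
      · rw [← prod_X_sub_C_univ]
        exact Splits.prod fun c _ => Splits.X_sub_C c
      · exact FiniteField.X_pow_card_sub_X_ne_zero F Fintype.one_lt_card
      · rw [hcard]; exact dvd_pow_pow_sub_self_of_dvd hen
    have h2 := card_rootSet_eq_natDegree (K := F) hsep (by simpa using hspl)
    rw [FiniteField.X_pow_card_sub_X_natDegree_eq F h1] at h2
    rw [← h2, ← Nat.card_eq_fintype_card]
    apply Nat.card_congr
    apply Equiv.subtypeEquivRight
    intro x
    have hP0 : P ≠ 0 := FiniteField.X_pow_card_sub_X_ne_zero F h1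
    rw [mem_rootSet, RingHom.mem_eqLocusField]
    rw [and_iff_right hP0]
    simp [hP, iterateFrobenius_def, sub_eq_zero]
  · rw [RingHom.mem_eqLocusField, iterateFrobenius_def] at hl
    exact hl

lemma eval_hP (f : F → F) (y c : F) : eval c (hP f y) = 0 ↔ cntL f y c ≠ 0 := by
  rw [hP, eval_prod, Finset.prod_eq_zero_iff]
  simp only [Finset.mem_filter, Finset.mem_univ, true_and, eval_sub, eval_X, eval_C, sub_eq_zero]
  constructor
  · rintro ⟨c', h, rfl⟩; exact h
  · intro h; exact ⟨c, h, rfl⟩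

lemma cnt_self_ne_zero (f : F → F) (y x : F) : cntL f y (f x - y * x) ≠ 0 :=
  Finset.card_ne_zero.mpr ⟨x, by simp⟩

lemma two_mul_le_of_lt {p n a b : ℕ} (hp : p.Prime) (ha : a ∣ p ^ n) (hb : b ∣ p ^ n)
    (hab : a < b) : 2 * a ≤ b := by
  obtain ⟨i, _, rfl⟩ := (Nat.dvd_prime_pow hp).mp ha
  obtain ⟨j, _, rfl⟩ := (Nat.dvd_prime_pow hp).mp hb
  have hij : i < j := (Nat.pow_lt_pow_iff_right hp.one_lt).mp hab
  calc 2 * p ^ i ≤ p * p ^ i := Nat.mul_le_mul_right _ hp.two_le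
    _ = p ^ (i + 1) := by rw [pow_succ']
    _ ≤ p ^ j := Nat.pow_le_pow_right hp.pos hij

lemma no_extra_point (p n : ℕ) (hp : p.Prime) [CharP F p] (hcard : Fintype.card F = p ^ n)
    (f : F → F) (h : ∀ y ∈ dirF f, ∀ c, p ∣ cntL f y c) (s : ℕ) (hs : 1 < s)
    (hex : ∃ y ∈ dirF f, sdF f y = s) (hmin : ∀ y ∈ dirF f, s ≤ sdF f y)
    (a b : F) (hab : b ≠ f a)
    (hW : ∀ y ∈ dirF f, sdF f y = s → cntL f y (b - y * a) ≠ 0) : False := by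
  have hq2 := two_le_card (F := F)
  have hdvd : ∀ y, sdF f y ∣ p ^ n := fun y => hcard ▸ Nat.gcd_dvd_left _ _
  have hsp := sum_sdF p hp f h
  have hsl := sum_slopes f a b
  set A := (dirF f).filter fun y => sdF f y = s with hA
  set B := (dirF f).filter fun y => ¬ sdF f y = s with hB
  have hAB : A.card + B.card = (dirF f).card :=
    Finset.card_filter_add_card_filter_not _
  have hApos : 0 < A.card := by
    obtain ⟨y, hy, hys⟩ := hex
    exact Finset.card_pos.mpr ⟨y, by simp [hA, hy, hys]⟩
  -- first count
  have c1 : A.card * (s - 1) + B.card * (2 * s - 1) ≤ Fintype.card F - 1 := by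
    rw [← hsp, ← Finset.sum_filter_add_sum_filter_not (dirF f) (fun y => sdF f y = s)]
    apply Nat.add_le_add
    · rw [← smul_eq_mul]
      apply Finset.card_nsmul_le_sum
      intro y hy
      rw [(Finset.mem_filter.mp hy).2]
    · rw [← smul_eq_mul]
      apply Finset.card_nsmul_le_sum
      intro y hy
      obtain ⟨hy1, hy2⟩ := Finset.mem_filter.mp hy
      obtain ⟨y0, hy0, hy0s⟩ := hex
      have := two_mul_le_of_lt hp (hy0s ▸ hdvd y0) (hdvd y)
        (lt_of_le_of_ne (hmin y hy1) (Ne.symm hy2))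
      omega
  -- second count
  have hcnt : ∀ y, ((Finset.univ.erase a).filter fun x => f x - y * x = b - y * a).card
      = cntL f y (b - y * a) := by
    intro y
    rw [cntL, Finset.filter_erase, Finset.erase_eq_of_notMem]
    simp only [Finset.mem_filter, Finset.mem_univ, true_and]
    intro he
    exact hab (by linear_combination -he)
  have c2 : A.card * s + (dirF f)ᶜ.card ≤ Fintype.card F - 1 := by
    rw [← hsl, ← Finset.sum_add_sum_compl (dirF f)]
    apply Nat.add_le_add
    · refine le_trans ?_ (Finset.sum_le_sum_of_subset (Finset.filter_subset (fun y => sdF f y = s) _))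
      rw [← smul_eq_mul]
      apply Finset.card_nsmul_le_sum
      intro y hy
      obtain ⟨hy1, hy2⟩ := Finset.mem_filter.mp hy
      rw [hcnt]
      have h0 := hW y hy1 hy2
      obtain ⟨x, hx⟩ := Finset.card_ne_zero.mp h0
      rw [← (Finset.mem_filter.mp hx).2, cnt_eq_sdF p hp f h, hy2]
    · rw [Finset.card_eq_sum_ones]
      apply Finset.sum_le_sum
      intro y hy
      rw [hcnt]
      have hy' : y ∉ dirF f := by simpa using hy
      have hinj : Function.Injective (fun x => f x - y * x) := by
        intro a b hab
        by_contra hne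
        exact hy' (by
          simp only [dirF, Finset.mem_filter, Finset.mem_univ, true_and]
          exact ⟨a, b, hne, hab⟩)
      obtain ⟨x, hx⟩ := Finite.surjective_of_injective hinj (b - y * a)
      exact Finset.card_pos.mpr ⟨x, by simpa using hx⟩
  rw [Finset.card_compl] at c2
  have hle : (dirF f).card ≤ Fintype.card F := Finset.card_le_univ _
  obtain ⟨y, hy, hys⟩ := hex
  have hc := hP_card p hp f h y
  rw [hys] at hc
  obtain ⟨t, rfl⟩ : ∃ t, s = t + 2 := ⟨s - 2, by omega⟩
  have e1 : t + 2 - 1 = t + 1 := by omega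
  have e2 : 2 * (t + 2) - 1 = 2 * t + 3 := by omega
  rw [e1, e2] at c1
  set N := (dirF f).card
  set Q := (hP f y).natDegree
  have c2' : A.card * (t + 2) + 1 ≤ N := by omega
  have c1' : A.card * (t + 1) + B.card * (2 * t + 3) + 1 ≤ Fintype.card F := by omega
  by_cases hlt : sdF f y < Fintype.card F
  · have hl := lower_bound p hp f h y hy hlt
    have hl' : Q + 1 ≤ N := hl
    nlinarith
  · have : sdF f y ≤ Fintype.card F := Nat.le_of_dvd (by omega) (Nat.gcd_dvd_left _ _)
    nlinarith

lemma linear_set (p n : ℕ) (hp : p.Prime) [CharP F p] (hcard : Fintype.card F = p ^ n)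
    (f : F → F) (h : ∀ y ∈ dirF f, ∀ c, p ∣ cntL f y c) (s : ℕ) (hs : 2 < s)
    (hex : ∃ y ∈ dirF f, sdF f y = s) (hmin : ∀ y ∈ dirF f, s ≤ sdF f y)
    (hN : (s - 1) * (dirF f).card ≤ Fintype.card F - 1) :
    (∃ e, s = p ^ e ∧ e ∣ n) ∧ ∃ K : Subfield F, Nat.card K = s ∧
      ∃ (W : Submodule K (F × F)) (v : F × F),
        {P : F × F | P.2 = f P.1} = (fun w => v + w) '' (W : Set (F × F)) := by
  have : Fact p.Prime := ⟨hp⟩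
  have hdvd : ∀ y, sdF f y ∣ p ^ n := fun y => hcard ▸ Nat.gcd_dvd_left _ _
  obtain ⟨e, he⟩ : ∃ e, s = p ^ e := by
    obtain ⟨y, hy, hys⟩ := hex
    obtain ⟨i, _, hi⟩ := (Nat.dvd_prime_pow hp).mp (hdvd y)
    exact ⟨i, by rw [← hys, hi]⟩
  have he0 : 0 < e := by
    rcases Nat.eq_zero_or_pos e with h0 | h0
    · rw [h0, pow_zero] at he; omega
    · exact h0
  have hkey : ∀ y ∈ dirF f, sdF f y = s → ∃ κ : F, κ ≠ 0 ∧
      hP f y ^ p ^ e - C κ * hP f y = X ^ Fintype.card F - X := by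
    intro y hy hys
    have := key_poly p n e hp hcard f h y hy (by rw [hys, he]) (by omega) (by rw [hys]; exact hN)
    rw [hys, he] at this
    exact this
  have hen : e ∣ n := by
    obtain ⟨y, hy, hys⟩ := hex
    obtain ⟨κ, hκ, hH⟩ := hkey y hy hys
    refine e_dvd p n e hp hcard he0 κ hκ (hP f y) ?_ hH
    have := hP_card p hp f h y
    have hq2 := two_le_card (F := F)
    rw [hys] at this
    nlinarith
  refine ⟨⟨e, he, hen⟩, ?_⟩
  obtain ⟨K, hK, hKl⟩ := exists_subfield p n e hp hcard he0 hen
  have hH : ∀ y ∈ dirF f, sdF f y = s → ∃ κ : F,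
      ((hP f y).comp (X + C (f 0))) ^ p ^ e - C κ * (hP f y).comp (X + C (f 0)) =
        X ^ Fintype.card F - X := by
    intro y hy hys
    obtain ⟨κ, _, h1⟩ := hkey y hy hys
    refine ⟨κ, ?_⟩
    have h2 := congrArg (fun P => P.comp (X + C (f 0))) h1
    simp only [sub_comp, pow_comp, mul_comp, C_comp, X_comp] at h2
    rw [h2, hcard, add_pow_char_pow, ← C_pow, ← hcard, FiniteField.pow_card]
    ring
  have hev : ∀ y u, eval u ((hP f y).comp (X + C (f 0))) = 0 ↔ cntL f y (u + f 0) ≠ 0 := by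
    intro y u
    rw [← eval_hP, eval_comp]; simp
  have hz : ∀ y, eval 0 ((hP f y).comp (X + C (f 0))) = 0 := by
    intro y
    rw [hev]
    simpa using cnt_self_ne_zero f y 0
  have hpe : 1 < p ^ e := by omega
  let W : Submodule K (F × F) :=
    { carrier := {w | ∀ y ∈ dirF f, sdF f y = s →
        eval (w.2 - y * w.1) ((hP f y).comp (X + C (f 0))) = 0}
      add_mem' := by
        intro w w' hw hw' y hy hys
        obtain ⟨κ, h1⟩ := hH y hy hys
        have := zeros_add p n e hp hcard hpe κ _ (hz y) h1 _ _ (hw y hy hys) (hw' y hy hys)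
        convert this using 2
        simp only [Prod.fst_add, Prod.snd_add]; ring
      zero_mem' := by
        intro y _ _
        simpa using hz y
      smul_mem' := by
        intro l w hw y hy hys
        obtain ⟨κ, h1⟩ := hH y hy hys
        have := zeros_smul p n e hp hcard hpe κ _ (hz y) h1 _ _ (hKl l l.2) (hw y hy hys)
        convert this using 2
        simp only [Prod.smul_fst, Prod.smul_snd, Subfield.smul_def, smul_eq_mul]; ring }
  refine ⟨K, by rw [hK, he], W, (0, f 0), ?_⟩
  ext ⟨a, b⟩
  simp only [Set.mem_setOf_eq, Set.mem_image, SetLike.mem_coe]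
  constructor
  · rintro rfl
    refine ⟨(a, f a - f 0), ?_, by simp⟩
    intro y hy hys
    rw [hev]
    have := cnt_self_ne_zero f y a
    convert this using 2
    ring
  · rintro ⟨⟨a', b'⟩, hw, hv⟩
    simp only [Prod.mk_add_mk, zero_add, Prod.mk.injEq] at hv
    obtain ⟨rfl, rfl⟩ := hv
    by_contra hne
    refine no_extra_point p n hp hcard f h s (by omega) hex hmin a' (f 0 + b') hne ?_
    intro y hy hys
    have := (hev y _).mp (hw y hy hys)
    convert this using 2
    ring

/-- The theorem for graphs of functions. -/
lemma main_graph (p n : ℕ) (hp : p.Prime) (hcard : Fintype.card F = p ^ n)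
    (f : F → F) (s : ℕ) (hex : ∃ y ∈ dirF f, sdF f y = s) (hmin : ∀ y ∈ dirF f, s ≤ sdF f y) :
    ((s = 1 ∧
        Fintype.card F + 3 ≤ 2 * (dirF f).card ∧ (dirF f).card ≤ Fintype.card F) ∨
      (1 < s ∧ s < Fintype.card F ∧ (∃ e : ℕ, s = p ^ e ∧ e ∣ n) ∧
        Fintype.card F / s + 1 ≤ (dirF f).card ∧
        (s - 1) * (dirF f).card ≤ Fintype.card F - 1) ∨
      (s = Fintype.card F ∧ (dirF f).card = 1)) ∧
    (2 < s → ∃ K : Subfield F, Nat.card K = s ∧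
      ∃ (W : Submodule K (F × F)) (v : F × F),
        {P : F × F | P.2 = f P.1} = (fun w => v + w) '' (W : Set (F × F))) := by
  have : Fact p.Prime := ⟨hp⟩
  have : CharP F p := charP_of_card_eq_prime_pow hcard
  have hq2 := two_le_card (F := F)
  have hn0 : n ≠ 0 := by
    rintro rfl; rw [pow_zero] at hcard; omega
  have hdvd : ∀ y, sdF f y ∣ p ^ n := fun y => hcard ▸ Nat.gcd_dvd_left _ _
  have hspos : 0 < s := by
    obtain ⟨y, hy, rfl⟩ := hex
    exact Nat.pos_of_dvd_of_pos (hdvd y) (pow_pos hp.pos n)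
  rcases Nat.lt_or_ge 1 s with hs1 | hs1
  swap
  · have hs : s = 1 := by omega
    refine ⟨Or.inl ⟨hs, ?_, Finset.card_le_univ _⟩, fun h2 => by omega⟩
    obtain ⟨y, hy, hys⟩ := hex
    refine redei_bound f y hy fun hd => ?_
    have h1 := dvd_cnt_of_derivative p f y hd
    have h2 : p ∣ sdF f y :=
      Nat.dvd_gcd (hcard ▸ dvd_pow_self p hn0) (Finset.dvd_gcd fun c _ => h1 c)
    rw [hys, hs] at h2
    exact hp.one_lt.ne' (Nat.dvd_one.mp h2)
  · have h : ∀ y ∈ dirF f, ∀ c, p ∣ cntL f y c := by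
      intro y hy c
      have h1 : sdF f y ∣ cntL f y c :=
        (Nat.gcd_dvd_right _ _).trans (Finset.gcd_dvd (Finset.mem_univ c))
      refine dvd_trans ?_ h1
      obtain ⟨i, _, hi⟩ := (Nat.dvd_prime_pow hp).mp (hdvd y)
      rw [hi]
      apply dvd_pow_self
      rintro rfl
      have := hmin y hy
      rw [hi, pow_zero] at this
      omega
    have hN : (s - 1) * (dirF f).card ≤ Fintype.card F - 1 := by
      rw [← sum_sdF p hp f h, mul_comm, ← smul_eq_mul]
      apply Finset.card_nsmul_le_sum
      intro y hy
      have := hmin y hy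
      omega
    refine ⟨Or.inr ?_, fun h2 => (linear_set p n hp hcard f h s h2 hex hmin hN).2⟩
    have hsle : s ≤ Fintype.card F := by
      obtain ⟨y, hy, rfl⟩ := hex
      exact Nat.le_of_dvd (by omega) (Nat.gcd_dvd_left _ _)
    have hDpos : 0 < (dirF f).card := by
      obtain ⟨y, hy, _⟩ := hex
      exact Finset.card_pos.mpr ⟨y, hy⟩
    rcases hsle.lt_or_eq with hlt | heq
    · refine Or.inl ⟨hs1, hlt, ?_, ?_, hN⟩
      · rcases Nat.lt_or_ge 2 s with h2 | h2
        · exact (linear_set p n hp hcard f h s h2 hex hmin hN).1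
        · obtain ⟨y, hy, hys⟩ := hex
          obtain ⟨i, _, hi⟩ := (Nat.dvd_prime_pow hp).mp (hdvd y)
          have hs2 : s = 2 := by omega
          refine ⟨1, ?_, one_dvd _⟩
          have hp2 : p ∣ 2 := by
            rw [← hs2, ← hys, hi]
            apply dvd_pow_self
            rintro rfl
            simp at hi; omega
          rw [hs2, pow_one]
          exact ((Nat.prime_dvd_prime_iff_eq hp Nat.prime_two).mp hp2).symm
      · obtain ⟨y, hy, hys⟩ := hex
        have h1 := lower_bound p hp f h y hy (by omega)
        have h2 := hP_card p hp f h y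
        rw [hys] at h2
        rw [← h2, Nat.mul_div_cancel_left _ hspos]
        exact h1
    · refine Or.inr ⟨heq, ?_⟩
      rw [heq] at hN
      have : (Fintype.card F - 1) * (dirF f).card ≤ (Fintype.card F - 1) * 1 := by omega
      have := Nat.le_of_mul_le_mul_left this (by omega)
      omega

end BBBSS

/-- Blokhuis–Ball–Brouwer–Storme–Szőnyi; Ball. Let `q = p^h`,
`U ⊆ AG(2,q)` with `|U| = q`, not determining `∞`, and `s = min_{y∈D} s(y)`. Then
either `s = 1` and `(q+3)/2 ≤ |D| ≤ q`; or `1 < s < q`, `GF(s)` is a subfield of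
`GF(q)` (i.e. `s = p^e` with `e ∣ h`) and `q/s + 1 ≤ |D| ≤ (q-1)/(s-1)`; or `s = q`
and `|D| = 1`. Moreover, if `s > 2` then `U` is a `GF(s)`-linear affine set, i.e.
a coset of a `GF(s)`-submodule of `GF(q)²`. -/
theorem blokhuis_ball_brouwer_storme_szonyi_ball
    {F : Type*} [Field F] [Fintype F] (p h : ℕ) (hp : p.Prime) (hh : 0 < h)
    (hcard : Fintype.card F = p ^ h) (U : Set (F × F))
    (hUcard : U.ncard = Fintype.card F) (hinf : none ∉ dirSet U) :
    ((sMin U = 1 ∧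
        Fintype.card F + 3 ≤ 2 * (dirSet U).ncard ∧ (dirSet U).ncard ≤ Fintype.card F) ∨
      (1 < sMin U ∧ sMin U < Fintype.card F ∧ (∃ e : ℕ, sMin U = p ^ e ∧ e ∣ h) ∧
        Fintype.card F / sMin U + 1 ≤ (dirSet U).ncard ∧
        (sMin U - 1) * (dirSet U).ncard ≤ Fintype.card F - 1) ∨
      (sMin U = Fintype.card F ∧ (dirSet U).ncard = 1)) ∧
    (2 < sMin U → ∃ K : Subfield F, Nat.card K = sMin U ∧
      ∃ (W : Submodule K (F × F)) (v : F × F),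
        U = (fun w => v + w) '' (W : Set (F × F))) := by
  have hfin : U.Finite := Set.toFinite U
  have hinjU : Set.InjOn Prod.fst U := by
    intro P hP Q hQ he
    by_contra hne
    exact hinf ⟨P, hP, Q, hQ, hne, by simp [direction, he]⟩
  have himg : Prod.fst '' U = Set.univ := by
    apply Set.eq_of_subset_of_ncard_le (Set.subset_univ _)
    rw [Set.ncard_image_of_injOn hinjU, hUcard, Set.ncard_univ, Nat.card_eq_fintype_card]
  have hsec : ∀ x : F, ∃ z, (x, z) ∈ U := by
    intro x
    obtain ⟨⟨a, b⟩, hP, rfl⟩ : x ∈ Prod.fst '' U := by rw [himg]; trivial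
    exact ⟨b, hP⟩
  choose f hf using hsec
  have hU : U = {P : F × F | P.2 = f P.1} := by
    ext ⟨a, b⟩
    simp only [Set.mem_setOf_eq]
    constructor
    · intro hP
      have := hinjU hP (hf a) rfl
      exact congrArg Prod.snd this
    · rintro rfl; exact hf a
  have hD : dirSet U = some '' (dirF f : Set F) := by
    ext d
    constructor
    · rintro ⟨⟨a, b⟩, hP, ⟨a', b'⟩, hQ, hne, hd⟩
      rw [hU] at hP hQ
      simp only [Set.mem_setOf_eq] at hP hQ
      subst hP hQ
      have haa : a ≠ a' := by rintro rfl; exact hne rfl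
      simp only [direction, if_neg haa] at hd
      refine ⟨_, ?_, hd⟩
      have h0 : a - a' ≠ 0 := sub_ne_zero.mpr haa
      simp only [dirF, Finset.coe_filter, Finset.mem_univ, true_and, Set.mem_setOf_eq]
      refine ⟨a, a', haa, ?_⟩
      field_simp
      ring
    · rintro ⟨y, hy, rfl⟩
      simp only [dirF, Finset.coe_filter, Finset.mem_univ, true_and, Set.mem_setOf_eq] at hy
      obtain ⟨a, a', haa, he⟩ := hy
      refine ⟨(a, f a), hf a, (a', f a'), hf a', fun h0 => haa (congrArg Prod.fst h0), ?_⟩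
      have h0 : a - a' ≠ 0 := sub_ne_zero.mpr haa
      simp only [direction, if_neg haa]
      congr 1
      rw [div_eq_iff h0]
      linear_combination he
  have hcnt : ∀ y c, lineCount U (some y) c = cntL f y c := by
    intro y c
    have h1 : {P ∈ U | onLine (some y) c P} =
        (fun x => (x, f x)) '' ((Finset.univ.filter fun x => f x - y * x = c : Finset F) : Set F) := by
      ext ⟨a, b⟩
      rw [hU]
      simp only [onLine, Set.mem_setOf_eq, Finset.coe_filter, Finset.mem_univ, true_and,
        Set.mem_image, Prod.mk.injEq]
      constructor
      · rintro ⟨rfl, h2⟩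
        exact ⟨a, by rw [h2]; ring, rfl, rfl⟩
      · rintro ⟨x, h2, rfl, rfl⟩
        exact ⟨rfl, by rw [← h2]; ring⟩
    rw [lineCount, h1, Set.ncard_image_of_injective _ (fun a b hab => congrArg Prod.fst hab),
      Set.ncard_coe_finset, cntL]
  have hsd : ∀ y, sdir U (some y) = sdF f y := by
    intro y
    simp only [sdir, sdF, hcnt]
  have hNcard : (dirSet U).ncard = (dirF f).card := by
    rw [hD, Set.ncard_image_of_injective _ (Option.some_injective F), Set.ncard_coe_finset]
  have hne : (sdir U '' dirSet U).Nonempty := by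
    obtain ⟨a, a', haa⟩ := exists_pair_ne F
    exact ⟨_, _, ⟨(a, f a), hf a, (a', f a'), hf a', fun h0 => haa (congrArg Prod.fst h0), rfl⟩, rfl⟩
  have hex : ∃ y ∈ dirF f, sdF f y = sMin U := by
    obtain ⟨d, hd, he⟩ := Nat.sInf_mem hne
    rw [hD] at hd
    obtain ⟨y, hy, rfl⟩ := hd
    exact ⟨y, hy, by rw [← hsd]; exact he⟩
  have hmin : ∀ y ∈ dirF f, sMin U ≤ sdF f y := by
    intro y hy
    apply Nat.sInf_le
    exact ⟨some y, by rw [hD]; exact ⟨y, hy, rfl⟩, hsd y⟩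
  have := main_graph p h hp hcard f (sMin U) hex hmin
  rw [hNcard]
  rw [← hU] at this
  exact this
end
end

section
/- (Szőnyi; Blokhuis.) Let q = p be a prime, let U ⊆ GF(p)^2 with 1 < |U| ≤ p, let D be the set of directions determined by U, and suppose ∞ ∉ D. Then either 2|D| ≥ |U| + 3 (and |D| ≤ p), or U is contained in a single line and |D| = 1. -/
open Polynomial
open scoped Classical

noncomputable section

/-- The polynomial `∏ (1 + c i T)`. -/
def sbS {R ι : Type*} [CommRing R] (s : Finset ι) (c : ι → R) : R[X] :=
  ∏ i ∈ s, (1 + C (c i) * X)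

/-- The inverse power series of `sbS`. -/
def sbI {R ι : Type*} [CommRing R] (s : Finset ι) (c : ι → R) : PowerSeries R :=
  ∏ i ∈ s, PowerSeries.mk fun j => (- c i) ^ j

/-- The truncated inverse. -/
def sbH {R ι : Type*} [CommRing R] (k : ℕ) (s : Finset ι) (c : ι → R) : R[X] :=
  PowerSeries.trunc (k + 1) (sbI s c)

lemma sbS_mul_sbI {R ι : Type*} [CommRing R] (s : Finset ι) (c : ι → R) :
    (sbS s c : PowerSeries R) * sbI s c = 1 := by
  unfold sbS sbI
  rw [← Polynomial.coeToPowerSeries.ringHom_apply, map_prod, ← Finset.prod_mul_distrib]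
  apply Finset.prod_eq_one
  intro i _
  ext j
  rw [Polynomial.coeToPowerSeries.ringHom_apply]
  rcases j with _ | j
  · simp [add_mul, mul_assoc]
  · simp [add_mul, mul_assoc, PowerSeries.coeff_succ_X_mul, PowerSeries.coeff_C_mul, pow_succ,
      PowerSeries.coeff_one]
    ring

/-- Degree tracking relation. -/
def SbRel {F : Type*} [Field F] (A : PowerSeries F[X]) (B : PowerSeries F) : Prop :=
  ∀ j, (PowerSeries.coeff j A).natDegree ≤ j ∧
    (PowerSeries.coeff j A).coeff j = PowerSeries.coeff j B

lemma SbRel.one {F : Type*} [Field F] : SbRel (1 : PowerSeries F[X]) 1 := by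
  intro j
  rw [PowerSeries.coeff_one, PowerSeries.coeff_one]
  split_ifs with h
  · subst h; simp
  · simp

lemma SbRel.mul {F : Type*} [Field F] {A A' : PowerSeries F[X]} {B B' : PowerSeries F}
    (h : SbRel A B) (h' : SbRel A' B') : SbRel (A * A') (B * B') := by
  intro j
  rw [PowerSeries.coeff_mul, PowerSeries.coeff_mul]
  constructor
  · apply Polynomial.natDegree_sum_le_of_forall_le
    intro x hx
    have := Finset.HasAntidiagonal.mem_antidiagonal.mp hx
    refine Polynomial.natDegree_mul_le.trans ?_
    have h1 := (h x.1).1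
    have h2 := (h' x.2).1
    omega
  · rw [Polynomial.finsetSum_coeff]
    apply Finset.sum_congr rfl
    intro x hx
    have := Finset.HasAntidiagonal.mem_antidiagonal.mp hx
    rw [← this, Polynomial.coeff_mul_add_eq_of_natDegree_le (h x.1).1 (h' x.2).1,
      (h x.1).2, (h' x.2).2]

lemma SbRel.prod {F ι : Type*} [Field F] (s : Finset ι) {A : ι → PowerSeries F[X]}
    {B : ι → PowerSeries F} (h : ∀ i, SbRel (A i) (B i)) :
    SbRel (∏ i ∈ s, A i) (∏ i ∈ s, B i) := by
  induction s using Finset.induction_on with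
  | empty => simpa using SbRel.one
  | insert a s ha ih =>
    rw [Finset.prod_insert ha, Finset.prod_insert ha]
    exact (h a).mul ih

lemma SbRel.trunc {F : Type*} [Field F] {A : PowerSeries F[X]} {B : PowerSeries F} (k : ℕ)
    (h : SbRel A B) :
    SbRel (PowerSeries.trunc k A : PowerSeries F[X]) (PowerSeries.trunc k B : PowerSeries F) := by
  intro j
  rw [Polynomial.coeff_coe, Polynomial.coeff_coe, PowerSeries.coeff_trunc, PowerSeries.coeff_trunc]
  split_ifs
  · exact h j
  · simp

lemma sbRel_G {F : Type*} [Field F] (k : ℕ) (s : Finset (F × F)) :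
    SbRel ((sbS s (fun P => C P.1 * X - C P.2) *
        sbH k s (fun P => C P.1 * X - C P.2) : F[X][X]) : PowerSeries F[X])
      ((sbS s (fun P => P.1) * sbH k s (fun P => P.1) : F[X]) : PowerSeries F) := by
  rw [Polynomial.coe_mul, Polynomial.coe_mul]
  have key : ∀ P : F × F, (C P.1 * X - C P.2 : F[X]).natDegree ≤ 1 := fun P => by
    compute_degree
  apply SbRel.mul
  · unfold sbS
    rw [← Polynomial.coeToPowerSeries.ringHom_apply, map_prod,
      ← Polynomial.coeToPowerSeries.ringHom_apply, map_prod]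
    apply SbRel.prod
    intro P j
    rw [Polynomial.coeToPowerSeries.ringHom_apply, Polynomial.coeToPowerSeries.ringHom_apply,
      Polynomial.coeff_coe, Polynomial.coeff_coe]
    rcases j with _ | _ | j
    · simp
    · have h1 : (1 + C (C P.1 * X - C P.2) * X : F[X][X]).coeff 1 = C P.1 * X - C P.2 := by
        simp [Polynomial.coeff_one]
      have h2 : (1 + C P.1 * X : F[X]).coeff 1 = P.1 := by
        simp [Polynomial.coeff_one]
      rw [zero_add, h1, h2]
      exact ⟨key P, by simp [Polynomial.coeff_C]⟩
    · have h1 : (1 + C (C P.1 * X - C P.2) * X : F[X][X]).coeff (j+1+1) = 0 := by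
        simp [Polynomial.coeff_one, Polynomial.coeff_X, -map_sub]
      have h2 : (1 + C P.1 * X : F[X]).coeff (j+1+1) = 0 := by
        simp [Polynomial.coeff_one, Polynomial.coeff_X]
      rw [h1, h2]; simp
  · unfold sbH
    apply SbRel.trunc
    unfold sbI
    apply SbRel.prod
    intro P j
    rw [PowerSeries.coeff_mk, PowerSeries.coeff_mk]
    have key' : (-(C P.1 * X - C P.2) : F[X]).natDegree ≤ 1 := by
      rw [Polynomial.natDegree_neg]; exact key P
    constructor
    · simpa using Polynomial.natDegree_pow_le_of_le j key'
    · have := Polynomial.coeff_pow_of_natDegree_le (m := j) key'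
      rw [mul_one] at this
      rw [this]
      simp [Polynomial.coeff_C]

lemma sbS_map {R R' ι : Type*} [CommRing R] [CommRing R'] (f : R →+* R') (s : Finset ι)
    (c : ι → R) : (sbS s c).map f = sbS s (fun i => f (c i)) := by
  simp [sbS, Polynomial.map_prod]

lemma sbH_map {R R' ι : Type*} [CommRing R] [CommRing R'] (f : R →+* R') (k : ℕ) (s : Finset ι)
    (c : ι → R) : (sbH k s c).map f = sbH k s (fun i => f (c i)) := by
  have : PowerSeries.map f (sbI s c) = sbI s (fun i => f (c i)) := by
    unfold sbI
    rw [map_prod]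
    apply Finset.prod_congr rfl
    intro i _
    ext j
    simp
  unfold sbH
  rw [← this]
  ext j
  rw [Polynomial.coeff_map, PowerSeries.coeff_trunc, PowerSeries.coeff_trunc]
  split_ifs <;> simp

lemma sb_prod_univ {F : Type*} [Field F] [Fintype F] :
    (∏ x : F, (1 + C x * X) : F[X]) = 1 - X ^ (Fintype.card F - 1) := by
  have h1 : (∏ x : F, (X - C x) : F[X]) = X ^ Fintype.card F - X := by
    have h0 := FiniteField.X_pow_card_sub_X_natDegree_eq F (Fintype.one_lt_card (α := F))
    have hm : (X ^ Fintype.card F - X : F[X]).Monic :=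
      Polynomial.monic_X_pow_sub (by rw [degree_X]; exact_mod_cast Fintype.one_lt_card)
    have hr := FiniteField.roots_X_pow_card_sub_X F
    have h9 := Polynomial.prod_multiset_X_sub_C_of_monic_of_roots_card_eq hm
      (by rw [h0, hr]; simp)
    rw [hr] at h9
    exact h9
  have hc : 0 < Fintype.card F := Fintype.card_pos
  have h2 : (∏ x ∈ Finset.univ.erase (0 : F), (X - C x) : F[X]) = X ^ (Fintype.card F - 1) - 1 := by
    have h3 := Finset.mul_prod_erase Finset.univ (fun x : F => (X - C x : F[X])) (Finset.mem_univ 0)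
    rw [h1] at h3
    apply mul_left_cancel₀ (Polynomial.X_ne_zero (R := F))
    simp only [map_zero, sub_zero] at h3
    rw [h3, mul_sub, ← pow_succ', Nat.sub_add_cancel hc, mul_one]
  have h4 : (∏ x ∈ Finset.univ.erase (0 : F), (-x)) = -1 := by
    have := congrArg (Polynomial.eval 0) h2
    rw [Polynomial.eval_prod] at this
    have h5 : Fintype.card F - 1 ≠ 0 := by
      have := Fintype.one_lt_card (α := F)
      omega
    simpa [h5] using this
  rw [← Finset.mul_prod_erase Finset.univ _ (Finset.mem_univ (0 : F))]
  simp only [map_zero, zero_mul, add_zero, one_mul]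
  have h6 : (∏ x ∈ Finset.univ.erase (0 : F), (1 + C x * X) : F[X]) =
      ∏ x ∈ Finset.univ.erase (0 : F), (C x * (X - C (-x⁻¹))) := by
    apply Finset.prod_congr rfl
    intro x hx
    have hx0 : x ≠ 0 := (Finset.mem_erase.mp hx).1
    rw [mul_sub, ← C_mul]
    simp [hx0, add_comm]
  have h7 : (∏ x ∈ Finset.univ.erase (0 : F), (X - C (-x⁻¹)) : F[X]) =
      ∏ x ∈ Finset.univ.erase (0 : F), (X - C x) := by
    apply Finset.prod_nbij' (fun x => -x⁻¹) (fun x => -x⁻¹) <;> simp [inv_neg]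
  have h8 : (∏ x ∈ Finset.univ.erase (0 : F), x) = -1 := by
    rw [← h4]
    apply Finset.prod_nbij' (fun x => -x) (fun x => -x) <;> simp
  rw [h6, Finset.prod_mul_distrib, h7, h2, ← map_prod, h8]
  simp

lemma sb_G_inj {F ι : Type*} [Field F] [Fintype F] (s : Finset ι) (c : ι → F) (k : ℕ)
    (hk : s.card + k = Fintype.card F) (hs : 2 ≤ s.card) (hc : Set.InjOn c s) :
    sbS s c * sbH k s c = 1 - X ^ (Fintype.card F - 1) := by
  set q0 : F[X] := ∏ x ∈ Finset.univ \ s.image c, (1 + C x * X) with hq0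
  have hS : sbS s c = ∏ x ∈ s.image c, (1 + C x * X) := by
    rw [Finset.prod_image hc]; rfl
  have h1 : sbS s c * q0 = 1 - X ^ (Fintype.card F - 1) := by
    rw [hS, hq0, mul_comm, Finset.prod_sdiff (Finset.subset_univ _), sb_prod_univ]
  have hd : q0.natDegree ≤ k := by
    refine (Polynomial.natDegree_prod_le _ _).trans ?_
    refine (Finset.sum_le_card_nsmul _ _ 1 ?_).trans ?_
    · intro x _; compute_degree
    · rw [Finset.card_univ_sdiff, Finset.card_image_of_injOn hc, smul_eq_mul]; omega
  have h2 : (q0 : PowerSeries F) = (1 - PowerSeries.X ^ (Fintype.card F - 1)) * sbI s c := by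
    have h3 := congrArg (fun q : F[X] => (q : PowerSeries F)) h1
    simp only [Polynomial.coe_mul] at h3
    have h4 : ((1 - X ^ (Fintype.card F - 1) : F[X]) : PowerSeries F) =
        1 - PowerSeries.X ^ (Fintype.card F - 1) := by
      simp
    rw [← h4, ← h3, mul_right_comm, sbS_mul_sbI, one_mul]
  have h5 : q0 = sbH k s c := by
    ext j
    unfold sbH
    rw [PowerSeries.coeff_trunc]
    split_ifs with hj
    · rw [← Polynomial.coeff_coe, h2, sub_mul, one_mul, map_sub, PowerSeries.coeff_X_pow_mul',
        if_neg (by omega), sub_zero]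
    · exact Polynomial.coeff_eq_zero_of_natDegree_lt (by omega)
  rw [← h5, h1]

lemma sb_reflect_S {R ι : Type*} [CommRing R] (s : Finset ι) (c : ι → R) :
    (sbS s c).natDegree ≤ s.card ∧ (sbS s c).reflect s.card = ∏ i ∈ s, (X + C (c i)) := by
  unfold sbS
  induction s using Finset.induction_on with
  | empty => simp
  | insert a s ha ih =>
    rw [Finset.prod_insert ha, Finset.prod_insert ha, Finset.card_insert_of_notMem ha]
    have h1 : (1 + C (c a) * X : R[X]).natDegree ≤ 1 := by compute_degree
    constructor
    · refine Polynomial.natDegree_mul_le.trans ?_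
      have := ih.1
      omega
    · rw [add_comm s.card 1, Polynomial.reflect_mul _ _ h1 ih.1, ih.2]
      congr 1
      rw [Polynomial.reflect_add, Polynomial.reflect_one, Polynomial.reflect_C_mul]
      congr 1
      · simp
      · have : (X : R[X]).reflect 1 = 1 := by
          have := Polynomial.reflect_monomial (R := R) 1 1
          simpa using this
        rw [this, mul_one]

lemma sb_lacunary {F ι : Type*} [Field F] [Fintype F] (p : ℕ) (hp : p.Prime)
    (hcard : Fintype.card F = p) (s : Finset ι) (c : ι → F) (g : F[X]) (d : ℕ) (hd : d ≤ p)
    (hg : g.degree < d) (hdvd : (∏ i ∈ s, (X + C (c i))) ∣ X ^ p + g)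
    (hninj : ¬ Set.InjOn c s) (hnc : ¬ ∃ e, ∀ i ∈ s, c i = e) :
    s.card + 3 ≤ 2 * d := by
  haveI : Fact p.Prime := ⟨hp⟩
  haveI : CharP F p := charP_of_card_eq_prime hcard
  have hfr : ∀ x : F, x ^ p = x := fun x => by rw [← hcard]; exact FiniteField.pow_card x
  have hgd : g.natDegree < p ∨ g = 0 := by
    by_cases h0 : g = 0
    · exact Or.inr h0
    · left
      rw [Polynomial.degree_eq_natDegree h0] at hg
      have : g.natDegree < d := by exact_mod_cast hg
      omega
  have hroot : ∀ i ∈ s, (X ^ p + g).eval (- c i) = 0 := by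
    intro i hi
    obtain ⟨q, hq⟩ := (Finset.dvd_prod_of_mem (fun i => (X + C (c i) : F[X])) hi).trans hdvd
    rw [hq]; simp
  have hg' : derivative g ≠ 0 := by
    intro h
    have hgC : g = C (g.coeff 0) := by
      ext j
      rcases j with _ | j
      · simp
      · rw [Polynomial.coeff_C_succ]
        by_cases hj : j + 1 < p
        · have h1 := congrArg (fun q => Polynomial.coeff q j) h
          simp only [Polynomial.coeff_derivative, Polynomial.coeff_zero] at h1
          rcases mul_eq_zero.mp h1 with h2 | h2
          · exact h2
          · exfalso
            have h3 : ((j + 1 : ℕ) : F) = 0 := by exact_mod_cast h2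
            rw [CharP.cast_eq_zero_iff F p] at h3
            exact absurd (Nat.le_of_dvd (by omega) h3) (by omega)
        · rcases hgd with h1 | h1
          · exact Polynomial.coeff_eq_zero_of_natDegree_lt (by omega)
          · simp [h1]
    apply hnc
    refine ⟨g.coeff 0, fun i hi => ?_⟩
    have h1 := hroot i hi
    rw [hgC] at h1
    simp only [eval_add, eval_pow, eval_X, eval_C, hfr] at h1
    linear_combination -h1
  have hg0 : g ≠ 0 := by rintro rfl; simp at hg'
  have hndp : 0 < g.natDegree := by
    by_contra h
    apply hg'
    exact Polynomial.derivative_of_natDegree_zero (by omega)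
  have hXg : X + g ≠ 0 := by
    intro h
    have hgX : g = -X := by linear_combination h
    apply hninj
    intro i hi j hj hij
    by_contra hne
    have h1 : (X + C (c i)) * (X + C (c i)) ∣ (X ^ p - X : F[X]) := by
      have h2 : ∏ k ∈ ({i, j} : Finset ι), (X + C (c k)) ∣ (∏ k ∈ s, (X + C (c k)) : F[X]) := by
        apply Finset.prod_dvd_prod_of_subset
        intro k hk
        rcases Finset.mem_insert.mp hk with h | h
        · subst h; exact hi
        · rw [Finset.mem_singleton] at h; subst h; exact hj
      rw [Finset.prod_pair hne, ← hij] at h2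
      have h3 := h2.trans hdvd
      rwa [hgX, ← sub_eq_add_neg] at h3
    have h4 : Squarefree (X ^ p - X : F[X]) :=
      (galois_poly_separable p p (dvd_refl p)).squarefree
    have h5 := h4 _ h1
    have h6 := Polynomial.natDegree_eq_zero_of_isUnit h5
    rw [Polynomial.natDegree_X_add_C] at h6
    omega
  have hR : (∏ i ∈ s, (X + C (c i)) : F[X]) = ((s.val.map (fun i => - c i)).map
      (fun a => X - C a)).prod := by
    simp [Multiset.map_map, Function.comp_def]
  set M : Multiset F := s.val.map (fun i => - c i) with hM
  have hP0 : X ^ p + g ≠ 0 := by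
    intro h
    have : g = - X ^ p := by linear_combination h
    rcases hgd with h1 | h1
    · rw [this] at h1; simp at h1
    · exact hg0 h1
  have hle : M ≤ (X + g).roots + (derivative g).roots := by
    have hMP : M ≤ (X ^ p + g).roots := by
      rw [← Multiset.prod_X_sub_C_dvd_iff_le_roots hP0, ← hR]
      exact hdvd
    rw [Multiset.le_iff_count]
    intro x
    have h1 := Multiset.count_le_of_le x hMP
    rw [Polynomial.count_roots] at h1
    rw [Multiset.count_add, Polynomial.count_roots, Polynomial.count_roots]
    by_cases hx : Multiset.count x M = 0
    · omega
    have h2 : (X - C x) ^ Multiset.count x M ∣ X ^ p + g :=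
      (pow_dvd_pow _ h1).trans (Polynomial.pow_rootMultiplicity_dvd _ _)
    have h3 : (X - C x) ^ (Multiset.count x M - 1) ∣ derivative g := by
      have := Polynomial.pow_sub_one_dvd_derivative_of_pow_dvd h2
      rwa [derivative_add, derivative_X_pow, CharP.cast_eq_zero F p, C_0, zero_mul, zero_add] at this
    have h4 : Multiset.count x M - 1 ≤ (derivative g).rootMultiplicity x :=
      (Polynomial.le_rootMultiplicity_iff hg').mpr h3
    have h5 : 1 ≤ (X + g).rootMultiplicity x := by
      apply (Polynomial.rootMultiplicity_pos hXg).mpr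
      have h6 := (dvd_pow_self _ hx).trans h2
      rw [Polynomial.dvd_iff_isRoot] at h6
      simp only [IsRoot.def, eval_add, eval_pow, eval_X, hfr] at h6 ⊢
      exact h6
    omega
  have hcardle := Multiset.card_le_card hle
  rw [Multiset.card_add] at hcardle
  have hMc : Multiset.card M = s.card := by simp [hM]
  have h1 := Polynomial.card_roots' (X + g)
  have h2 := Polynomial.card_roots' (derivative g)
  have h3 := Polynomial.natDegree_derivative_lt (p := g) (by omega)
  have h4 : (X + g).natDegree ≤ g.natDegree := by
    refine (Polynomial.natDegree_add_le _ _).trans ?_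
    simp; omega
  have h5 : g.natDegree < d := by
    rw [Polynomial.degree_eq_natDegree hg0] at hg
    exact_mod_cast hg
  omega

/-- Core bound. `D` is a finset of slopes containing every slope at which `U` is not injective. -/
lemma sb_core {F : Type*} [Field F] [Fintype F] (p : ℕ) (hp : p.Prime)
    (hcard : Fintype.card F = p) (U : Finset (F × F)) (D : Finset F)
    (hU1 : 2 ≤ U.card) (hU2 : U.card ≤ p) (hinf : Set.InjOn (fun P : F × F => P.1) U)
    (hD : ∀ m, m ∉ D → Set.InjOn (fun P : F × F => P.1 * m - P.2) U)
    (hD2 : 2 ≤ D.card) (m : F) (hm : ¬ Set.InjOn (fun P : F × F => P.1 * m - P.2) U)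
    (hnc : ¬ ∃ e, ∀ P ∈ U, P.1 * m - P.2 = e) :
    U.card + 3 ≤ 2 * D.card := by
  have hDp : D.card ≤ p := by rw [← hcard]; exact Finset.card_le_univ D
  obtain ⟨k, hk⟩ : ∃ k, U.card + k = p := ⟨p - U.card, by omega⟩
  set c : F × F → F[X] := fun P => C P.1 * X - C P.2 with hc
  set G : F[X][X] := sbS U c * sbH k U c with hG
  have hmap : ∀ x : F, G.map (evalRingHom x) =
      sbS U (fun P => P.1 * x - P.2) * sbH k U (fun P => P.1 * x - P.2) := by
    intro x
    rw [hG, Polynomial.map_mul, sbS_map, sbH_map]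
    simp [hc]
  have hzero : ∀ j, 1 ≤ j → j ≤ p - D.card → G.coeff j = 0 := by
    intro j hj1 hj2
    have hrel := sbRel_G k U j
    rw [Polynomial.coeff_coe, Polynomial.coeff_coe,
      sb_G_inj U (fun P => P.1) k (by omega) hU1 hinf] at hrel
    change (G.coeff j).natDegree ≤ j ∧ (G.coeff j).coeff j = _ at hrel
    have hco : (1 - X ^ (Fintype.card F - 1) : F[X]).coeff j = 0 := by
      rw [Polynomial.coeff_sub, Polynomial.coeff_one, Polynomial.coeff_X_pow,
        if_neg (by omega), if_neg (by omega), sub_zero]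
    rw [hco] at hrel
    have hlt : (G.coeff j).natDegree < j := by
      rcases hrel.1.lt_or_eq with h | h
      · exact h
      · have h1 := hrel.2
        nth_rewrite 2 [← h] at h1
        rw [Polynomial.coeff_natDegree, Polynomial.leadingCoeff_eq_zero] at h1
        rw [h1] at h
        simp at h
        omega
    apply Polynomial.eq_zero_of_natDegree_lt_card_of_eval_eq_zero' _ (Finset.univ \ D)
    · intro x hx
      have hxD : x ∉ D := (Finset.mem_sdiff.mp hx).2
      have h1 := congrArg (fun q => Polynomial.coeff q j) (hmap x)
      rw [sb_G_inj U _ k (by omega) hU1 (hD x hxD)] at h1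
      simp only [hco, Polynomial.coeff_map] at h1
      exact h1
    · rw [Finset.card_univ_sdiff]; omega
  set cm : F × F → F := fun P => P.1 * m - P.2 with hcm
  set Gm : F[X] := sbS U cm * sbH k U cm with hGm
  have hGm0 : ∀ j, 1 ≤ j → j ≤ p - D.card → Gm.coeff j = 0 := by
    intro j h1 h2
    rw [hGm, ← hmap m, Polynomial.coeff_map, hzero j h1 h2, map_zero]
  have hGm1 : Gm.coeff 0 = 1 := by
    rw [hGm, Polynomial.mul_coeff_zero]
    simp [sbS, sbH, sbI, Polynomial.coeff_zero_prod, PowerSeries.coeff_trunc, map_prod]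
  have hSd := sb_reflect_S U cm
  have hHd : (sbH k U cm).natDegree ≤ k := by
    have := PowerSeries.natDegree_trunc_lt (sbI U cm) k
    unfold sbH
    omega
  have hGd : Gm.natDegree ≤ p := by
    refine Polynomial.natDegree_mul_le.trans ?_
    have := hSd.1
    omega
  have hrefl : Gm.reflect p = (∏ P ∈ U, (X + C (cm P))) * (sbH k U cm).reflect k := by
    rw [hGm, ← hk, Polynomial.reflect_mul _ _ hSd.1 hHd, hSd.2]
  apply sb_lacunary p hp hcard U cm (Gm.reflect p - X ^ p) D.card hDp ?_ ?_ hm hnc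
  · rw [Polynomial.degree_lt_iff_coeff_zero]
    intro j hj
    rw [Polynomial.coeff_sub, Polynomial.coeff_reflect, Polynomial.coeff_X_pow]
    rcases lt_trichotomy j p with h | h | h
    · rw [if_neg (by omega), Polynomial.revAt_le h.le, hGm0 _ (by omega) (by omega), sub_zero]
    · rw [if_pos h, h, Polynomial.revAt_le le_rfl, Nat.sub_self, hGm1, sub_self]
    · rw [if_neg (by omega), Polynomial.revAt_eq_self_of_lt h,
        Polynomial.coeff_eq_zero_of_natDegree_lt (by omega), sub_zero]
  · rw [add_sub_cancel, hrefl]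
    exact dvd_mul_right _ _

/-- Szőnyi; Blokhuis. Let `q = p` be prime, `U ⊆ AG(2,p)` with
`1 < |U| ≤ p` not determining the vertical direction `∞`. Then either
`2|D| ≥ |U| + 3` (and `|D| ≤ p`), or `U` is contained in a single line and `|D| = 1`. -/
theorem szonyi_blokhuis_directions_prime
    {F : Type*} [Field F] [Fintype F] (p : ℕ) (hp : p.Prime)
    (hcard : Fintype.card F = p) (U : Set (F × F))
    (hU1 : 1 < U.ncard) (hU2 : U.ncard ≤ p)
    (hinf : none ∉ dirSet U) :
    (U.ncard + 3 ≤ 2 * (dirSet U).ncard ∧ (dirSet U).ncard ≤ p) ∨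
      ((∃ (y : Option F) (c : F), ∀ P ∈ U, onLine y c P) ∧ (dirSet U).ncard = 1) := by
  have hUf : U.Finite := Set.toFinite U
  have hDf : (dirSet U).Finite := Set.toFinite _
  have hfst : ∀ P ∈ U, ∀ Q ∈ U, P.1 = Q.1 → P = Q := by
    intro P hP Q hQ h
    by_contra hne
    exact hinf ⟨P, hP, Q, hQ, hne, by simp [direction, h]⟩
  obtain ⟨A, hA, B, hB, hAB⟩ := (Set.one_lt_ncard hUf).mp hU1
  have hdAB : direction A B ∈ dirSet U := ⟨A, hA, B, hB, hAB, rfl⟩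
  by_cases hline : ∃ (y : Option F) (c : F), ∀ P ∈ U, onLine y c P
  · right
    refine ⟨hline, ?_⟩
    obtain ⟨y, c, hy⟩ := hline
    rcases y with _ | m
    · exact absurd (hfst A hA B hB ((hy A hA).trans (hy B hB).symm)) hAB
    · have key : ∀ P ∈ U, ∀ Q ∈ U, P ≠ Q → direction P Q = some m := by
        intro P hP Q hQ hne
        have h1 : P.1 ≠ Q.1 := fun h => hne (hfst P hP Q hQ h)
        have h2 : P.2 = m * P.1 + c := hy P hP
        have h3 : Q.2 = m * Q.1 + c := hy Q hQ
        have h4 : P.1 - Q.1 ≠ 0 := sub_ne_zero.mpr h1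
        rw [direction, if_neg h1, h2, h3]
        congr 1
        field_simp
        ring
      rw [Set.ncard_eq_one]
      refine ⟨some m, ?_⟩
      ext x
      rw [Set.mem_singleton_iff]
      constructor
      · rintro ⟨P, hP, Q, hQ, hne, rfl⟩
        exact key P hP Q hQ hne
      · rintro rfl
        exact ⟨A, hA, B, hB, hAB, key A hA B hB hAB⟩
  · left
    let D : Finset F := Finset.univ.filter (fun m => some m ∈ dirSet U)
    have hDset : dirSet U = some '' (D : Set F) := by
      ext x
      rcases x with _ | m
      · simp [hinf]
      · simp [D]
    have hDcard : (dirSet U).ncard = D.card := by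
      rw [hDset, Set.ncard_image_of_injective _ (Option.some_injective F), Set.ncard_coe_finset]
    have hUcard : U.ncard = hUf.toFinset.card := Set.ncard_eq_toFinset_card U hUf
    have hslope : ∀ P ∈ U, ∀ Q ∈ U, P ≠ Q → ∀ m : F,
        (P.1 * m - P.2 = Q.1 * m - Q.2 ↔ direction P Q = some m) := by
      intro P hP Q hQ hne m
      have h1 : P.1 ≠ Q.1 := fun h => hne (hfst P hP Q hQ h)
      have h4 : P.1 - Q.1 ≠ 0 := sub_ne_zero.mpr h1
      rw [direction, if_neg h1, Option.some_inj, div_eq_iff h4]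
      constructor
      · intro h; linear_combination -h
      · intro h; linear_combination -h
    have hA1 : A.1 ≠ B.1 := fun h => hAB (hfst A hA B hB h)
    obtain ⟨m, hm⟩ : ∃ m, direction A B = some m := ⟨_, if_neg hA1⟩
    have hmD : m ∈ D := by simp only [D, Finset.mem_filter, Finset.mem_univ, true_and]
                           rw [← hm]; exact hdAB
    have hnc : ¬ ∃ e, ∀ P ∈ hUf.toFinset, P.1 * m - P.2 = e := by
      rintro ⟨e, he⟩
      apply hline
      refine ⟨some m, -e, fun P hP => ?_⟩
      have := he P (by simpa using hP)
      change P.2 = m * P.1 + -e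
      linear_combination -this
    have hDp : D.card ≤ p := by rw [← hcard]; exact Finset.card_le_univ D
    rw [hDcard, hUcard]
    refine ⟨?_, hDp⟩
    apply sb_core p hp hcard hUf.toFinset D (by omega) (by omega) ?_ ?_ ?_ m ?_ hnc
    · intro P hP Q hQ h
      exact hfst P (by simpa using hP) Q (by simpa using hQ) h
    · intro x hx P hP Q hQ h
      by_contra hne
      have hP' : P ∈ U := by simpa using hP
      have hQ' : Q ∈ U := by simpa using hQ
      apply hx
      simp only [D, Finset.mem_filter, Finset.mem_univ, true_and]
      exact ⟨P, hP', Q, hQ', hne, (hslope P hP' Q hQ' hne x).mp h⟩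
    · by_contra hlt
      have hD1 : ∀ x ∈ D, x = m := fun x hx =>
        Finset.card_le_one.mp (by omega) x hx m hmD
      apply hnc
      refine ⟨A.1 * m - A.2, fun P hP => ?_⟩
      have hP' : P ∈ U := by simpa using hP
      by_cases hPA : P = A
      · rw [hPA]
      · rw [hslope P hP' A hA hPA]
        have h1 : P.1 ≠ A.1 := fun h => hPA (hfst P hP' A hA h)
        obtain ⟨x, hx⟩ : ∃ x, direction P A = some x := ⟨_, if_neg h1⟩
        rw [hx, hD1 x]
        simp only [D, Finset.mem_filter, Finset.mem_univ, true_and]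
        exact ⟨P, hP', A, hA, hPA, hx⟩
    · intro h
      exact hAB (h (by simpa using hA) (by simpa using hB) ((hslope A hA B hB hAB m).mpr hm))
end
end

section
/- Let q = p^h, let U ⊆ GF(q)^2 be nonempty with Rédei polynomial R(X,Y), and let y ∈ GF(q) be a determined direction (y ∈ D). Then R(X,y) ∈ GF(q)[X^{s(y)}] but R(X,y) ∉ GF(q)[X^{p·s(y)}]. -/
open Polynomial
open scoped Classical

noncomputable section

/-- The Rédei polynomial `R(X,Y) = ∏_{(a,b)∈U} (X - aY + b)`, as a polynomial in `X`
with coefficients in `GF(q)[Y]`. -/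
def redei {F : Type*} [Field F] (U : Finset (F × F)) : Polynomial (Polynomial F) :=
  ∏ P ∈ U, (X - C (C P.1 * X - C P.2))

/-- The quotient `Q(X,Y)` of `X^q - X` upon Euclidean division (in `X`) by the
(monic in `X`) Rédei polynomial. -/
def Qpoly {F : Type*} [Field F] [Fintype F] (U : Finset (F × F)) : Polynomial (Polynomial F) :=
  (X ^ Fintype.card F - X) /ₘ redei U

/-- `H(X,Y)`, defined by `-X - H(X,Y) = (X^q - X) mod R(X,Y)`, so that
`R·Q = X^q + H` with `deg_X H < deg_X R`. -/
def Hpoly {F : Type*} [Field F] [Fintype F] (U : Finset (F × F)) : Polynomial (Polynomial F) :=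
  -X - (X ^ Fintype.card F - X) %ₘ redei U

/-- The evaluation `R(X,y)` of the Rédei polynomial at `Y = y`. -/
def redeiAt {F : Type*} [Field F] (U : Finset (F × F)) (y : F) : Polynomial F :=
  (redei U).map (evalRingHom y)

/-- The evaluation `Q(X,y)`. -/
def QAt {F : Type*} [Field F] [Fintype F] (U : Finset (F × F)) (y : F) : Polynomial F :=
  (Qpoly U).map (evalRingHom y)

/-- The evaluation `H(X,y)`. -/
def HAt {F : Type*} [Field F] [Fintype F] (U : Finset (F × F)) (y : F) : Polynomial F :=
  (Hpoly U).map (evalRingHom y)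

/-- `g ∈ R[X^r]`: every power of `X` occurring in `g` with nonzero coefficient has
exponent divisible by `r`. -/
def inXpow {R : Type*} [Semiring R] (r : ℕ) (g : Polynomial R) : Prop :=
  ∀ i : ℕ, g.coeff i ≠ 0 → r ∣ i

theorem lineCount_eq_s6 {F : Type*} [Field F] (U : Finset (F × F)) (y c : F) :
    lineCount (↑U : Set (F × F)) (some y) c = (U.filter fun P => P.2 - y * P.1 = c).card := by
  unfold lineCount
  rw [← Set.ncard_coe_finset]
  congr 1
  ext P
  simp only [onLine, Set.mem_ofPred_eq, Finset.coe_filter, Finset.mem_coe]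
  constructor
  · rintro ⟨h1, h2⟩
    exact ⟨h1, by rw [h2]; ring⟩
  · rintro ⟨h1, h2⟩
    exact ⟨h1, by rw [← h2]; ring⟩

theorem redeiAt_eq {F : Type*} [Field F] (U : Finset (F × F)) (y : F) :
    redeiAt U y = ∏ P ∈ U, (X - C (-(P.2 - y * P.1))) := by
  unfold redeiAt redei
  rw [Polynomial.map_prod]
  refine Finset.prod_congr rfl fun P _ => ?_
  rw [Polynomial.map_sub, map_X, map_C]
  congr 2
  simp
  ring

theorem redeiAt_eq_lines {F : Type*} [Field F] [Fintype F] (U : Finset (F × F)) (y : F) :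
    redeiAt U y = ∏ c : F, (X - C (-c)) ^ lineCount (↑U : Set (F × F)) (some y) c := by
  rw [redeiAt_eq, ← Finset.prod_fiberwise U (fun P => P.2 - y * P.1)]
  refine Finset.prod_congr rfl fun c _ => ?_
  rw [lineCount_eq_s6, ← Finset.prod_const]
  refine Finset.prod_congr rfl fun P hP => ?_
  rw [(Finset.mem_filter.1 hP).2]

theorem rootMultiplicity_redeiAt {F : Type*} [Field F] (U : Finset (F × F)) (y c : F) :
    (redeiAt U y).rootMultiplicity (-c) = lineCount (↑U : Set (F × F)) (some y) c := by
  have h : redeiAt U y = ((U.val.map fun P => -(P.2 - y * P.1)).map fun a => X - C a).prod := by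
    rw [redeiAt_eq, Multiset.map_map]
    rfl
  rw [← count_roots, h, roots_multiset_prod_X_sub_C, Multiset.count_map, lineCount_eq_s6]
  simp only [neg_inj, eq_comm (a := c)]
  rfl

theorem lineCount_le {F : Type*} [Field F] [Fintype F] (U : Finset (F × F)) (y c : F) :
    lineCount (↑U : Set (F × F)) (some y) c ≤ Fintype.card F := by
  rw [lineCount_eq_s6, ← Finset.card_univ]
  refine Finset.card_le_card_of_injOn (fun P => P.1) (fun _ _ => Finset.mem_coe.2 (Finset.mem_univ _)) ?_
  intro P hP Q hQ hPQ
  have h1 := (Finset.mem_filter.1 (Finset.mem_coe.1 hP)).2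
  have h2 := (Finset.mem_filter.1 (Finset.mem_coe.1 hQ)).2
  simp only at hPQ
  refine Prod.ext hPQ ?_
  rw [← h2, hPQ] at h1
  exact sub_left_injective h1

/-- For a nonempty `U ⊆ AG(2,q)` and a determined direction
`y ∈ D ∩ GF(q)`, the Rédei polynomial satisfies `R(X,y) ∈ GF(q)[X^{s(y)}]` but
`R(X,y) ∉ GF(q)[X^{p·s(y)}]`. -/
theorem redei_at_determined_direction
    {F : Type*} [Field F] [Fintype F] (p h : ℕ) (hp : p.Prime) (hh : 0 < h)
    (hcard : Fintype.card F = p ^ h) (U : Finset (F × F)) (hU : U.Nonempty)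
    (y : F) (hy : some y ∈ dirSet (↑U : Set (F × F))) :
    inXpow (sdir (↑U : Set (F × F)) (some y)) (redeiAt U y) ∧
      ¬ inXpow (p * sdir (↑U : Set (F × F)) (some y)) (redeiAt U y) := by
  have hpf : Fact p.Prime := ⟨hp⟩
  have hchar : CharP F p := charP_of_card_eq_prime_pow hcard
  have hsq : sdir (↑U : Set (F × F)) (some y) ∣ p ^ h := by
    rw [← hcard]; exact Nat.gcd_dvd_left _ _
  have hsl : ∀ c : F, sdir (↑U : Set (F × F)) (some y) ∣ lineCount (↑U : Set (F × F)) (some y) c :=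
    fun c => (Nat.gcd_dvd_right _ _).trans (Finset.gcd_dvd (Finset.mem_univ c))
  obtain ⟨e, he, hs⟩ := (Nat.dvd_prime_pow hp).1 hsq
  constructor
  · rw [hs]
    rw [hs] at hsl
    choose m hm using hsl
    have hR : redeiAt U y = (∏ c : F, (X - C (-c)) ^ m c) ^ p ^ e := by
      rw [redeiAt_eq_lines, ← Finset.prod_pow]
      refine Finset.prod_congr rfl fun c _ => ?_
      rw [hm c, ← pow_mul, mul_comm]
    rw [hR, ← map_iterateFrobenius_expand p]
    intro i hi
    by_contra hni
    apply hi
    rw [coeff_map, coeff_expand (pow_pos hp.pos e), if_neg hni, map_zero]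
  · intro hin
    rw [hs, ← pow_succ'] at hin
    have hR : expand F (p ^ (e + 1)) (contract (p ^ (e + 1)) (redeiAt U y)) = redeiAt U y := by
      ext i
      rw [coeff_expand (pow_pos hp.pos _), coeff_contract (pow_pos hp.pos _).ne']
      split_ifs with hd
      · rw [Nat.div_mul_cancel hd]
      · by_contra hne
        exact hd (hin i (Ne.symm hne))
    have hdvd : ∀ c : F, p ^ (e + 1) ∣ lineCount (↑U : Set (F × F)) (some y) c := by
      intro c
      rw [← rootMultiplicity_redeiAt, ← hR, rootMultiplicity_expand_pow]
      exact dvd_mul_right _ _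
    rcases he.lt_or_eq with hlt | heq
    · have h1 : p ^ (e + 1) ∣ sdir (↑U : Set (F × F)) (some y) := by
        refine Nat.dvd_gcd ?_ (Finset.dvd_gcd fun c _ => hdvd c)
        rw [hcard]
        exact pow_dvd_pow p hlt
      rw [hs] at h1
      have := (Nat.pow_dvd_pow_iff_le_right hp.one_lt).1 h1
      omega
    · obtain ⟨P, hP⟩ := hU
      have hpos : 0 < lineCount (↑U : Set (F × F)) (some y) (P.2 - y * P.1) := by
        rw [lineCount_eq_s6]
        exact Finset.card_pos.2 ⟨P, Finset.mem_filter.2 ⟨hP, rfl⟩⟩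
      have h1 := Nat.le_of_dvd hpos (hdvd _)
      have h2 := lineCount_le U y (P.2 - y * P.1)
      rw [hcard, ← heq] at h2
      have h3 := Nat.pow_lt_pow_right hp.one_lt (Nat.lt_add_one e)
      omega
end
end

section
/- Let q = p^h, let U ⊆ GF(q)^2 with Rédei polynomial R(X,Y), and define Q(X,Y), H(X,Y) by R(X,Y)·Q(X,Y) = X^q + H(X,Y) with deg_X H < deg_X R. If y ∈ GF(q) is a direction not determined by U (y ∉ D), then R(X,y)·Q(X,y) = X^q − X (i.e. H(X,y) = −X), and in particular Q(X,y) is totally reducible: it splits over GF(q) into distinct linear factors. -/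
open Polynomial
open scoped Classical

noncomputable section

/-- For `U ⊆ AG(2,q)` and a non-determined direction `y ∉ D`,
one has `R(X,y)·Q(X,y) = X^q - X` (i.e. `H(X,y) = -X`), and `Q(X,y)` is totally
reducible, splitting over `GF(q)` into distinct linear factors. -/
theorem RQ_at_nondetermined_direction
    {F : Type*} [Field F] [Fintype F] (p h : ℕ) (hp : p.Prime) (hh : 0 < h)
    (hcard : Fintype.card F = p ^ h) (U : Finset (F × F))
    (y : F) (hy : some y ∉ dirSet (↑U : Set (F × F))) :
    redeiAt U y * QAt U y = X ^ Fintype.card F - X ∧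
      HAt U y = -X ∧
      ∃ T : Finset F, QAt U y = ∏ x ∈ T, (X - C x) := by
  have hm : (redei U).Monic := monic_prod_of_monic _ _ fun P _ => monic_X_sub_C _
  have hinj : Set.InjOn (fun P : F × F => P.1 * y - P.2) (U : Set (F × F)) := by
    intro P hP Q hQ hPQ
    by_contra hne
    apply hy
    refine ⟨P, hP, Q, hQ, hne, ?_⟩
    simp only at hPQ
    have hx : P.1 ≠ Q.1 := by
      intro h1
      apply hne
      rw [h1] at hPQ
      exact Prod.ext h1 (sub_right_injective hPQ)
    have hx' : P.1 - Q.1 ≠ 0 := sub_ne_zero.mpr hx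
    rw [direction, if_neg hx, Option.some_inj, div_eq_iff hx']
    linear_combination -hPQ
  have hR : redeiAt U y = ∏ x ∈ U.image (fun P : F × F => P.1 * y - P.2), (X - C x) := by
    rw [Finset.prod_image hinj, redeiAt, redei, Polynomial.map_prod]
    refine Finset.prod_congr rfl fun P _ => ?_
    simp
  set S := U.image (fun P : F × F => P.1 * y - P.2) with hS
  have hall : (X ^ Fintype.card F - X : F[X]) = ∏ x : F, (X - C x) := by
    have h1 : 1 < Fintype.card F := Fintype.one_lt_card
    have hmon : (X ^ Fintype.card F - X : F[X]).Monic :=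
      monic_X_pow_sub (by rw [degree_X]; exact_mod_cast h1)
    have h2 := prod_multiset_X_sub_C_of_monic_of_roots_card_eq hmon (by
      rw [FiniteField.roots_X_pow_card_sub_X, FiniteField.X_pow_card_sub_X_natDegree_eq F h1]
      rfl)
    rw [FiniteField.roots_X_pow_card_sub_X] at h2
    exact h2.symm
  have hsplit : (X ^ Fintype.card F - X : F[X]) = redeiAt U y * ∏ x ∈ Sᶜ, (X - C x) := by
    rw [hall, hR, Finset.prod_mul_prod_compl]
  have hmy : (redeiAt U y).Monic := hm.map _
  have hQ : QAt U y = ∏ x ∈ Sᶜ, (X - C x) := by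
    rw [QAt, Qpoly, map_divByMonic _ hm]
    simp only [Polynomial.map_sub, Polynomial.map_pow, map_X]
    rw [hsplit]
    exact mul_divByMonic_cancel_left _ hmy
  refine ⟨by rw [hQ, hsplit], ?_, Sᶜ, hQ⟩
  rw [HAt, Hpoly, Polynomial.map_sub, map_modByMonic _ hm]
  simp only [Polynomial.map_sub, Polynomial.map_pow, map_X, Polynomial.map_neg]
  rw [hsplit, ← redeiAt, (modByMonic_eq_zero_iff_dvd hmy).mpr (Dvd.intro _ rfl), sub_zero]
end
end

section
/- Let q = p^h, let U ⊆ GF(q)^2 with |U| = n ≥ 2, with Rédei polynomial R(X,Y), and define Q(X,Y), H(X,Y) by R(X,Y)·Q(X,Y) = X^q + H(X,Y) with deg_X H < deg_X R. Suppose that for some y ∈ GF(q) the polynomial H(X,y) is a constant a ∈ GF(q). Then R(X,y) = (X + a)^n; consequently all points of U lie on the single affine line { (u,w) ∈ GF(q)^2 : w − uy = a } of direction y, and the set of directions determined by U is D = {y}. -/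
open Polynomial
open scoped Classical

noncomputable section

/-- If `|U| = n ≥ 2` and `H(X,y)` is a constant `a`, then
`R(X,y) = (X + a)^n`; consequently all points of `U` lie on the single affine line
`{(u,w) : w - u·y = a}` of direction `y`, and `D = {y}`. -/
theorem H_constant_implies_collinear
    {F : Type*} [Field F] [Fintype F] (p h : ℕ) (hp : p.Prime) (hh : 0 < h)
    (hcard : Fintype.card F = p ^ h) (U : Finset (F × F)) (n : ℕ)
    (hn : U.card = n) (hn2 : 2 ≤ n)
    (y : F) (a : F) (ha : HAt U y = C a) :
    redeiAt U y = (X + C a) ^ n ∧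
      (∀ P ∈ U, P.2 - P.1 * y = a) ∧
      dirSet (↑U : Set (F × F)) = {some y} := by
  have hR : redeiAt U y = ∏ P ∈ U, (X - C (P.1 * y - P.2)) := by
    simp [redeiAt, redei, Polynomial.map_prod]
  have hmon : (redei U).Monic := monic_prod_of_monic _ _ fun P _ => monic_X_sub_C _
  have key : redeiAt U y * QAt U y = X ^ Fintype.card F + C a := by
    have h1 : redei U * Qpoly U = X ^ Fintype.card F + Hpoly U := by
      have := modByMonic_add_div (X ^ Fintype.card F - X : Polynomial (Polynomial F)) (redei U)
      unfold Qpoly Hpoly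
      linear_combination this
    have h2 := congrArg (Polynomial.map (evalRingHom y)) h1
    rw [Polynomial.map_mul, Polynomial.map_add, Polynomial.map_pow, Polynomial.map_X] at h2
    rw [← ha]
    exact h2
  have hline : ∀ P ∈ U, P.2 - P.1 * y = a := by
    intro P hP
    have h3 := congrArg (Polynomial.eval (P.1 * y - P.2)) key
    have h4 : (redeiAt U y).eval (P.1 * y - P.2) = 0 := by
      rw [hR, eval_prod]
      exact Finset.prod_eq_zero hP (by simp)
    rw [eval_mul, h4, zero_mul, eval_add, eval_pow, eval_X, eval_C, FiniteField.pow_card] at h3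
    linear_combination h3
  refine ⟨?_, hline, ?_⟩
  · rw [hR, ← hn]
    apply Finset.prod_eq_pow_card
    intro P hP
    rw [← hline P hP]
    simp only [C_sub]
    ring
  · have hdir : ∀ P ∈ U, ∀ Q ∈ U, P ≠ Q → direction P Q = some y := by
      intro P hP Q hQ hne
      have e1 := hline P hP
      have e2 := hline Q hQ
      have hx : P.1 ≠ Q.1 := by
        intro hx
        apply hne
        refine Prod.ext hx ?_
        rw [hx] at e1
        linear_combination e1 - e2
      have hx' : P.1 - Q.1 ≠ 0 := sub_ne_zero.mpr hx
      rw [direction, if_neg hx]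
      congr 1
      rw [div_eq_iff hx']
      linear_combination e1 - e2
    ext d
    constructor
    · rintro ⟨P, hP, Q, hQ, hne, rfl⟩
      exact hdir P hP Q hQ hne
    · intro hd
      have hd' : d = some y := hd
      subst hd'
      obtain ⟨P, hP, Q, hQ, hne⟩ := Finset.one_lt_card.mp (by omega : 1 < U.card)
      exact ⟨P, hP, Q, hQ, hne, hdir P hP Q hQ hne⟩
end
end

section
/- Let q = p^h, let U ⊆ GF(q)^2 be nonempty with nonempty direction set D, with Rédei polynomial R(X,Y), and define Q(X,Y), H(X,Y) by R(X,Y)·Q(X,Y) = X^q + H(X,Y) with deg_X H < deg_X R. Assume D ⊄ {∞} and set t = min_{y ∈ D∩GF(q)} t(y). Then every monomial X^i·Y^j occurring with nonzero coefficient in X^q + H(X,Y) satisfies i = 1 or t | i; that is, X^q + H(X,Y) lies in the GF(q)[Y]-span of 1, X, X^t, X^{2t}, X^{3t}, …, X^q. -/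
open Polynomial
open scoped Classical

noncomputable section

/-- `t(y)` for a polynomial `H = H(X,y)`: the maximal power of `p` such that
`H ∈ GF(q)[X^{t(y)}]`, if `H` is not constant; and `q` if `H` is constant. -/
def tdir {F : Type*} [Field F] (p q : ℕ) (H : Polynomial F) : ℕ :=
  if H.natDegree = 0 then q
  else sSup {r : ℕ | (∃ e : ℕ, r = p ^ e) ∧ inXpow r H}

/-- `t = min_{y ∈ D ∩ GF(q)} t(y)`. -/
def tMin {F : Type*} [Field F] [Fintype F] (U : Finset (F × F)) (p : ℕ) : ℕ :=
  sInf {m : ℕ | ∃ y : F, some y ∈ dirSet (↑U : Set (F × F)) ∧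
    m = tdir p (Fintype.card F) (HAt U y)}

/-- Total degree of `f(X,Y)` at most `n`. -/
def totLe {F : Type*} [Field F] (n : ℕ) (f : Polynomial (Polynomial F)) : Prop :=
  ∀ i j : ℕ, n < i + j → (f.coeff i).coeff j = 0

theorem totLe_sub {F : Type*} [Field F] {n : ℕ} {f g : Polynomial (Polynomial F)}
    (hf : totLe n f) (hg : totLe n g) : totLe n (f - g) := by
  intro i j hij
  simp [hf i j hij, hg i j hij]

theorem totLe_mul {F : Type*} [Field F] {m n : ℕ} {f g : Polynomial (Polynomial F)}
    (hf : totLe m f) (hg : totLe n g) : totLe (m + n) (f * g) := by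
  intro i j hij
  rw [Polynomial.coeff_mul, Polynomial.finsetSum_coeff]
  refine Finset.sum_eq_zero fun a ha => ?_
  rw [Polynomial.coeff_mul]
  refine Finset.sum_eq_zero fun b hb => ?_
  rw [Finset.HasAntidiagonal.mem_antidiagonal] at ha hb
  rcases lt_or_ge m (a.1 + b.1) with h1 | h1
  · rw [hf _ _ h1, zero_mul]
  · rw [hg a.2 b.2 (by omega), mul_zero]

theorem totLe_one {F : Type*} [Field F] : totLe 0 (1 : Polynomial (Polynomial F)) := by
  intro i j hij
  rw [Polynomial.coeff_one]
  split_ifs with h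
  · rw [Polynomial.coeff_one, if_neg (by omega)]
  · simp

theorem totLe_mono {F : Type*} [Field F] {m n : ℕ} (hmn : m ≤ n)
    {f : Polynomial (Polynomial F)} (hf : totLe m f) : totLe n f :=
  fun i j hij => hf i j (by omega)

theorem totLe_X {F : Type*} [Field F] : totLe 1 (X : Polynomial (Polynomial F)) := by
  intro i j hij
  rw [Polynomial.coeff_X]
  split_ifs with h
  · rw [Polynomial.coeff_one, if_neg (by omega)]
  · simp

theorem totLe_X_pow {F : Type*} [Field F] (n : ℕ) :
    totLe n ((X : Polynomial (Polynomial F)) ^ n) := by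
  intro i j hij
  rw [Polynomial.coeff_X_pow]
  split_ifs with h
  · rw [Polynomial.coeff_one, if_neg (by omega)]
  · simp

theorem totLe_lin {F : Type*} [Field F] (a b : F) :
    totLe 1 (X - C (C a * X - C b) : Polynomial (Polynomial F)) := by
  refine totLe_sub totLe_X ?_
  intro i j hij
  rw [Polynomial.coeff_C]
  split_ifs with h
  · rw [Polynomial.coeff_sub, Polynomial.coeff_C_mul, Polynomial.coeff_X, Polynomial.coeff_C,
      if_neg (by omega), if_neg (by omega)]
    simp
  · simp

theorem totLe_redei {F : Type*} [Field F] (U : Finset (F × F)) : totLe U.card (redei U) := by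
  unfold redei
  induction U using Finset.induction_on with
  | empty => simpa using totLe_one
  | insert a s ha ih =>
    rw [Finset.prod_insert ha, Finset.card_insert_of_notMem ha, add_comm]
    exact totLe_mul (totLe_lin _ _) ih

theorem redei_monic {F : Type*} [Field F] (U : Finset (F × F)) : (redei U).Monic :=
  Polynomial.monic_prod_of_monic _ _ fun _ _ => Polynomial.monic_X_sub_C _

theorem redei_natDegree {F : Type*} [Field F] (U : Finset (F × F)) :
    (redei U).natDegree = U.card := by
  unfold redei
  rw [Polynomial.natDegree_prod_of_monic _ _ fun _ _ => Polynomial.monic_X_sub_C _]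
  simp [-map_sub, -map_mul]

theorem totLe_div {F : Type*} [Field F] (R : Polynomial (Polynomial F)) (hR : R.Monic)
    (hRt : totLe R.natDegree R) (n : ℕ) :
    ∀ (d : ℕ) (f : Polynomial (Polynomial F)), f.natDegree ≤ d → totLe n f →
      ∃ a r : Polynomial (Polynomial F), r + R * a = f ∧ r.degree < R.degree ∧ totLe n r := by
  intro d
  induction d using Nat.strong_induction_on with
  | _ d ih =>
  intro f hfd hf
  by_cases hlt : f.degree < R.degree
  · exact ⟨0, f, by simp, hlt, hf⟩
  have hle : R.degree ≤ f.degree := not_lt.mp hlt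
  have hf0 : f ≠ 0 := by
    rintro rfl
    rw [Polynomial.degree_zero, le_bot_iff, Polynomial.degree_eq_bot] at hle
    exact hR.ne_zero hle
  have hnat : R.natDegree ≤ f.natDegree := Polynomial.natDegree_le_natDegree hle
  have hlc : f.leadingCoeff ≠ 0 := by simpa using hf0
  have hfn : f.natDegree ≤ n := by
    by_contra hcon
    exact hlc (Polynomial.ext fun j => by
      simpa using hf f.natDegree j (by omega))
  set M : Polynomial (Polynomial F) :=
    C f.leadingCoeff * X ^ (f.natDegree - R.natDegree) with hM
  have hMt : totLe (n - R.natDegree) M := by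
    intro i j hij
    rw [hM, Polynomial.coeff_C_mul_X_pow]
    split_ifs with h
    · exact hf f.natDegree j (by omega)
    · simp
  have hg : totLe n (f - R * M) := by
    refine totLe_sub hf ?_
    have := totLe_mul hRt hMt
    rwa [show R.natDegree + (n - R.natDegree) = n by omega] at this
  have hdec : (f - R * M).degree < f.degree := Polynomial.div_wf_lemma ⟨hle, hf0⟩ hR
  by_cases hg0 : f - R * M = 0
  · refine ⟨M, 0, by rw [zero_add]; exact (sub_eq_zero.mp hg0).symm, ?_, by intro i j _; simp⟩
    rw [Polynomial.degree_zero, bot_lt_iff_ne_bot, Ne, Polynomial.degree_eq_bot]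
    exact hR.ne_zero
  · have hlt' := Polynomial.natDegree_lt_natDegree hg0 hdec
    obtain ⟨a, r, h1, h2, h3⟩ := ih _ (lt_of_lt_of_le hlt' hfd) (f - R * M) le_rfl hg
    refine ⟨a + M, r, ?_, h2, h3⟩
    rw [mul_add, ← add_assoc, h1]
    ring

theorem totLe_H {F : Type*} [Field F] [Fintype F] (U : Finset (F × F)) :
    totLe (Fintype.card F) (Hpoly U) := by
  have hX : totLe (Fintype.card F) (X : Polynomial (Polynomial F)) :=
    totLe_mono Fintype.card_pos totLe_X
  have h0 : totLe (Fintype.card F) (X ^ Fintype.card F - X : Polynomial (Polynomial F)) :=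
    totLe_sub (totLe_X_pow _) hX
  obtain ⟨a, r, h1, h2, h3⟩ := totLe_div (redei U) (redei_monic U)
    (by rw [redei_natDegree]; exact totLe_redei U) _ _ _ le_rfl h0
  have := (Polynomial.div_modByMonic_unique a r (redei_monic U) ⟨h1, h2⟩).2
  unfold Hpoly
  rw [this]
  refine totLe_sub ?_ h3
  intro i j hij
  rw [Polynomial.coeff_neg, Polynomial.coeff_neg, hX i j hij, neg_zero]

theorem HAt_of_not_mem {F : Type*} [Field F] [Fintype F] (U : Finset (F × F)) (y : F)
    (hy : some y ∉ dirSet (↑U : Set (F × F))) : HAt U y = -X := by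
  have hinj : Set.InjOn (fun P : F × F => P.1 * y - P.2) (↑U : Set (F × F)) := by
    intro P hP Q hQ hPQ
    by_contra hne
    apply hy
    refine ⟨P, hP, Q, hQ, hne, ?_⟩
    simp only at hPQ
    have h1 : P.1 ≠ Q.1 := by
      intro h
      apply hne
      rw [h] at hPQ
      exact Prod.ext h (sub_right_injective hPQ)
    unfold direction
    rw [if_neg h1, Option.some_inj, div_eq_iff (sub_ne_zero.mpr h1)]
    linear_combination -hPQ
  have hmap : (redei U).map (evalRingHom y)
      = ∏ a ∈ U.image (fun P : F × F => P.1 * y - P.2), (X - C a) := by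
    rw [Finset.prod_image hinj]
    unfold redei
    rw [Polynomial.map_prod]
    refine Finset.prod_congr rfl fun P _ => ?_
    rw [Polynomial.map_sub, Polynomial.map_X, Polynomial.map_C]
    simp
  have hdvd : (redei U).map (evalRingHom y) ∣ (X ^ Fintype.card F - X : Polynomial F) := by
    rw [hmap]
    refine (Finset.prod_dvd_prod_of_subset _ Finset.univ _ (Finset.subset_univ _)).trans ?_
    have := Polynomial.prod_multiset_X_sub_C_dvd (X ^ Fintype.card F - X : Polynomial F)
    rwa [FiniteField.roots_X_pow_card_sub_X] at this
  unfold HAt Hpoly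
  rw [Polynomial.map_sub, Polynomial.map_modByMonic _ (redei_monic U)]
  have h0 : (X ^ Fintype.card F - X : Polynomial (Polynomial F)).map (evalRingHom y)
      = X ^ Fintype.card F - X := by simp
  rw [h0, (Polynomial.modByMonic_eq_zero_iff_dvd ((redei_monic U).map _)).mpr hdvd]
  simp

theorem tdir_spec {F : Type*} [Field F] (p h : ℕ) (hp : p.Prime) (H : Polynomial F)
    (hH : ∀ i, p ^ h < i → H.coeff i = 0) :
    ∃ e ≤ h, tdir p (p ^ h) H = p ^ e ∧ inXpow (p ^ e) H := by
  unfold tdir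
  split_ifs with h0
  · refine ⟨h, le_rfl, rfl, fun i hi => ?_⟩
    have := Polynomial.le_natDegree_of_ne_zero hi
    have : i = 0 := by omega
    simp [this]
  · set S := {r : ℕ | (∃ e : ℕ, r = p ^ e) ∧ inXpow r H} with hS
    have hne : S.Nonempty := ⟨1, ⟨0, by simp⟩, fun i _ => one_dvd i⟩
    have hc : H.coeff H.natDegree ≠ 0 := by
      have : H ≠ 0 := by rintro rfl; simp at h0
      simpa using this
    have hbd : BddAbove S := ⟨H.natDegree, fun r hr =>
      Nat.le_of_dvd (Nat.pos_of_ne_zero h0) (hr.2 _ hc)⟩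
    obtain ⟨⟨e, he⟩, hx⟩ := Nat.sSup_mem hne hbd
    refine ⟨e, ?_, he, he ▸ hx⟩
    have h1 : p ^ e ≤ H.natDegree := by
      rw [← he]; exact Nat.le_of_dvd (Nat.pos_of_ne_zero h0) (hx _ hc)
    have h2 : H.natDegree ≤ p ^ h := by
      by_contra hcon
      exact hc (hH _ (by omega))
    exact (Nat.pow_le_pow_iff_right hp.one_lt).mp (h1.trans h2)

/-- Suppose `U` is nonempty and determines at least one direction
`y ∈ GF(q)` (i.e. `D ⊄ {∞}`), and let `t = min_{y ∈ D ∩ GF(q)} t(y)`. Then every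
monomial `X^i·Y^j` occurring with nonzero coefficient in `X^q + H(X,Y)` satisfies
`i = 1` or `t ∣ i`; that is, `R·Q = X^q + H(X,Y)` lies in the `GF(q)[Y]`-span of
`1, X, X^t, X^{2t}, …, X^q`. -/
theorem RQ_in_span_of_t_powers
    {F : Type*} [Field F] [Fintype F] (p h : ℕ) (hp : p.Prime) (hh : 0 < h)
    (hcard : Fintype.card F = p ^ h) (U : Finset (F × F)) (hU : U.Nonempty)
    (hD : ∃ y : F, some y ∈ dirSet (↑U : Set (F × F))) :
    ∀ i : ℕ, ((X : Polynomial (Polynomial F)) ^ Fintype.card F + Hpoly U).coeff i ≠ 0 →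
      i = 1 ∨ tMin U p ∣ i := by
  intro i hi
  by_contra hcon
  push Not at hcon
  obtain ⟨hi1, hti⟩ := hcon
  have htot := totLe_H U
  have hspec : ∀ y : F, ∃ e ≤ h, tdir p (Fintype.card F) (HAt U y) = p ^ e ∧
      inXpow (p ^ e) (HAt U y) := by
    intro y
    rw [hcard]
    refine tdir_spec p h hp _ fun i hi => ?_
    unfold HAt
    rw [Polynomial.coeff_map]
    have : (Hpoly U).coeff i = 0 :=
      Polynomial.ext fun j => by simpa using htot i j (by omega)
    rw [this, map_zero]
  have hne : {m : ℕ | ∃ y : F, some y ∈ dirSet (↑U : Set (F × F)) ∧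
      m = tdir p (Fintype.card F) (HAt U y)}.Nonempty := by
    obtain ⟨y, hy⟩ := hD
    exact ⟨_, y, hy, rfl⟩
  obtain ⟨y0, hy0, ht⟩ := Nat.sInf_mem hne
  change tMin U p = _ at ht
  obtain ⟨e0, he0, hte0, -⟩ := hspec y0
  rw [hte0] at ht
  have hi0 : i ≠ 0 := by rintro rfl; exact hti (dvd_zero _)
  have hiq : i ≠ Fintype.card F := by
    rintro rfl
    apply hti
    rw [ht, hcard]
    exact pow_dvd_pow p he0
  apply hi
  rw [Polynomial.coeff_add, Polynomial.coeff_X_pow, if_neg hiq, zero_add]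
  have heval : ∀ y : F, ((Hpoly U).coeff i).eval y = 0 := by
    intro y
    have hco : ((Hpoly U).coeff i).eval y = (HAt U y).coeff i := by
      unfold HAt
      rw [Polynomial.coeff_map, Polynomial.coe_evalRingHom]
    rw [hco]
    by_cases hy : some y ∈ dirSet (↑U : Set (F × F))
    · obtain ⟨e, he, hte, hx⟩ := hspec y
      by_contra hne0
      apply hti
      have hle : tMin U p ≤ tdir p (Fintype.card F) (HAt U y) := Nat.sInf_le ⟨y, hy, rfl⟩
      rw [hte, ht] at hle
      rw [ht]
      exact (pow_dvd_pow p ((Nat.pow_le_pow_iff_right hp.one_lt).mp hle)).trans (hx i hne0)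
    · rw [HAt_of_not_mem U y hy, Polynomial.coeff_neg, Polynomial.coeff_X, if_neg (Ne.symm hi1),
        neg_zero]
  have hdeg : ((Hpoly U).coeff i).natDegree < Fintype.card F := by
    by_contra hge
    have h1 : ((Hpoly U).coeff i).coeff ((Hpoly U).coeff i).natDegree = 0 :=
      htot _ _ (by omega)
    rw [Polynomial.coeff_natDegree, Polynomial.leadingCoeff_eq_zero] at h1
    rw [h1, Polynomial.natDegree_zero] at hge
    exact hge Fintype.card_pos
  exact Polynomial.eq_zero_of_natDegree_lt_card_of_eval_eq_zero _ Function.injective_id heval hdeg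
end
end

section
/- Let q = p^h, let U ⊆ GF(q)^2 with Rédei polynomial R(X,Y), and define Q(X,Y), H(X,Y) by R(X,Y)·Q(X,Y) = X^q + H(X,Y) with deg_X H < deg_X R. Fix y ∈ GF(q) and suppose that H(X,y) is not a constant polynomial and H(X,y) ≠ −X. Let t(y) be the maximal power of p with H(X,y) ∈ GF(q)[X^{t(y)}], write H(X,y) = f_y(X)^{t(y)} with f_y ∉ GF(q)[X^p], and let κ(y) be the number of roots of X^q + H(X,y) in GF(q) counted with multiplicity. Then κ(y) + t(y) ≤ (t(y) + 1) · t(y) · deg f_y = (t(y) + 1) · deg H(X,y). -/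
open Polynomial
open scoped Classical

noncomputable section

lemma roots_card_le_aux {F : Type*} [Field F] (g W : Polynomial F) (hW : W ≠ 0)
    (hg' : derivative g ≠ 0) (hgW : ∀ x, g.IsRoot x → W.IsRoot x) :
    g.roots.card ≤ W.natDegree + (derivative g).natDegree := by
  have hle : g.roots ≤ W.roots + (derivative g).roots := by
    rw [Multiset.le_iff_count]
    intro a
    rw [Multiset.count_add, count_roots, count_roots, count_roots]
    by_cases ha : g.IsRoot a
    · have h1 := (rootMultiplicity_pos hW).2 (hgW a ha)
      have h2 := rootMultiplicity_sub_one_le_derivative_rootMultiplicity_of_ne_zero g a hg'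
      omega
    · rw [rootMultiplicity_eq_zero ha]
      omega
  have h1 := Multiset.card_le_card hle
  rw [Multiset.card_add] at h1
  have h2 := card_roots' W
  have h3 := card_roots' (derivative g)
  omega

lemma tdir_mem_aux {F : Type*} [Field F] (p q : ℕ) (H : Polynomial F)
    (h0 : H.natDegree ≠ 0) : ∃ e : ℕ, tdir p q H = p ^ e := by
  have hm : sSup {r : ℕ | (∃ e : ℕ, r = p ^ e) ∧ inXpow r H} ∈
      {r : ℕ | (∃ e : ℕ, r = p ^ e) ∧ inXpow r H} := by
    apply Nat.sSup_mem
    · exact ⟨1, ⟨0, by simp⟩, fun i _ => one_dvd i⟩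
    · refine ⟨H.natDegree, ?_⟩
      rintro r ⟨-, hr⟩
      refine Nat.le_of_dvd (Nat.pos_of_ne_zero h0) (hr _ ?_)
      intro hc
      apply h0
      have : H = 0 := leadingCoeff_eq_zero.1 hc
      simp [this]
  unfold tdir
  rw [if_neg h0]
  exact hm.1

lemma natDegree_X_add_pow_le {F : Type*} [Field F] (f : Polynomial F) (n : ℕ)
    (hn : 0 < n * f.natDegree) : (X + f ^ n).natDegree ≤ n * f.natDegree := by
  refine (natDegree_add_le _ _).trans (max_le ?_ ?_)
  · rw [natDegree_X]; exact hn
  · rw [natDegree_pow]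

lemma kappa_aux {F : Type*} [Field F] [Fintype F] (p h e : ℕ) (hp : p.Prime)
    (hcard : Fintype.card F = p ^ h) (f : Polynomial F)
    (hd : 0 < f.natDegree) (hHX : f ^ (p ^ e) ≠ -X) (hfp : ¬ inXpow p f) :
    (X ^ Fintype.card F + f ^ (p ^ e)).roots.card + p ^ e ≤
      (p ^ e + 1) * (p ^ e * f.natDegree) := by
  have : Fact p.Prime := ⟨hp⟩
  have : CharP F p := charP_of_card_eq_prime_pow hcard
  have ht : 0 < p ^ e := pow_pos hp.pos e
  rcases lt_or_ge e h with heh | heh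
  · obtain ⟨k, rfl⟩ := Nat.exists_eq_add_of_lt heh
    set g : Polynomial F := X ^ (p ^ (k + 1)) + f with hg
    have hfac : (X ^ Fintype.card F + f ^ (p ^ e) : Polynomial F) = g ^ (p ^ e) := by
      rw [hg, add_pow_char_pow, ← pow_mul, ← pow_add, hcard]
      congr 3; omega
    have hgd : derivative g = derivative f := by
      rw [hg, derivative_add, derivative_X_pow]
      simp
    have hf' : derivative f ≠ 0 := by
      intro h0
      apply hfp
      intro i hi
      rcases i with _ | i
      · exact dvd_zero p
      have := congrArg (fun P => P.coeff i) h0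
      simp only [coeff_derivative, coeff_zero] at this
      rcases mul_eq_zero.1 this with h1 | h1
      · exact absurd h1 hi
      · exact (CharP.cast_eq_zero_iff F p (i + 1)).1 (by exact_mod_cast h1)
    have hW : (X + f ^ (p ^ e) : Polynomial F) ≠ 0 := by
      intro h0
      exact hHX (eq_neg_of_add_eq_zero_right h0)
    have key := roots_card_le_aux g (X + f ^ (p ^ e)) hW (hgd ▸ hf') (by
      intro x hx
      have h1 : (X ^ Fintype.card F + f ^ (p ^ e) : Polynomial F).eval x = 0 := by
        rw [hfac, eval_pow, hx.eq_zero, zero_pow ht.ne']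
      rw [IsRoot.def]
      simpa [FiniteField.pow_card] using h1)
    rw [hgd] at key
    have h1 := natDegree_X_add_pow_le f (p ^ e) (Nat.mul_pos ht hd)
    have h2 := natDegree_derivative_lt hd.ne'
    rw [hfac, roots_pow, Multiset.card_nsmul]
    have h3 : g.roots.card + 1 ≤ (p ^ e + 1) * f.natDegree := by
      have : (p ^ e + 1) * f.natDegree = p ^ e * f.natDegree + f.natDegree := by ring
      omega
    calc p ^ e * g.roots.card + p ^ e = p ^ e * (g.roots.card + 1) := by ring
      _ ≤ p ^ e * ((p ^ e + 1) * f.natDegree) := Nat.mul_le_mul_left _ h3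
      _ = _ := by ring
  · obtain ⟨k, rfl⟩ := Nat.exists_eq_add_of_le heh
    have hfac : (X ^ Fintype.card F + f ^ (p ^ (h + k)) : Polynomial F) =
        (X + f ^ (p ^ k)) ^ (p ^ h) := by
      rw [add_pow_char_pow, ← pow_mul, ← pow_add, hcard]
      congr 3; omega
    have h1 := natDegree_X_add_pow_le f (p ^ k) (Nat.mul_pos (pow_pos hp.pos k) hd)
    have h2 := (card_roots' (X + f ^ (p ^ k))).trans h1
    rw [hfac, roots_pow, Multiset.card_nsmul]
    have h3 : p ^ h * (X + f ^ (p ^ k)).roots.card ≤ p ^ (h + k) * f.natDegree := by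
      rw [pow_add, mul_assoc]; exact Nat.mul_le_mul_left _ h2
    have h4 : p ^ (h + k) ≤ p ^ (h + k) * (p ^ (h + k) * f.natDegree) :=
      Nat.le_mul_of_pos_right _ (Nat.mul_pos ht hd)
    rw [add_mul, one_mul]
    omega

/-- Fix `y ∈ GF(q)` with `H(X,y)` nonconstant and `H(X,y) ≠ -X`.
Write `t(y)` for the maximal power of `p` with `H(X,y) ∈ GF(q)[X^{t(y)}]`, write
`H(X,y) = f_y(X)^{t(y)}` with `f_y ∉ GF(q)[X^p]`, and let `κ(y)` be the number of
roots of `X^q + H(X,y)` in `GF(q)`, counted with multiplicity. Then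
`κ(y) + t(y) ≤ (t(y) + 1)·t(y)·deg f_y = (t(y) + 1)·deg H(X,y)`. -/
theorem kappa_bound_at_direction
    {F : Type*} [Field F] [Fintype F] (p h : ℕ) (hp : p.Prime) (hh : 0 < h)
    (hcard : Fintype.card F = p ^ h) (U : Finset (F × F)) (y : F)
    (hH0 : (HAt U y).natDegree ≠ 0) (hHX : HAt U y ≠ -X)
    (f : Polynomial F) (hf : HAt U y = f ^ tdir p (Fintype.card F) (HAt U y))
    (hfp : ¬ inXpow p f) :
    (X ^ Fintype.card F + HAt U y).roots.card + tdir p (Fintype.card F) (HAt U y) ≤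
        (tdir p (Fintype.card F) (HAt U y) + 1) *
          (tdir p (Fintype.card F) (HAt U y) * f.natDegree) ∧
      tdir p (Fintype.card F) (HAt U y) * f.natDegree = (HAt U y).natDegree := by
  obtain ⟨e, he⟩ := tdir_mem_aux p (Fintype.card F) (HAt U y) hH0
  rw [he] at hf ⊢
  have hdeg : p ^ e * f.natDegree = (HAt U y).natDegree := by
    rw [hf, natDegree_pow]
  refine ⟨?_, hdeg⟩
  have hd : 0 < f.natDegree := by
    rcases Nat.eq_zero_or_pos f.natDegree with h0 | h0
    · rw [h0, mul_zero] at hdeg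
      exact absurd hdeg.symm hH0
    · exact h0
  rw [hf] at hHX ⊢
  exact kappa_aux p h e hp hcard f hd hHX hfp
end
end

section
/- Let q = p^h, let U ⊆ GF(q)^2 be nonempty with nonempty direction set D, and let s = min_{y∈D} s(y). If s > 1, then (s − 1)·|D| ≤ |U| − 1, i.e. |D| ≤ (|U| − 1)/(s − 1). -/
open Polynomial
open scoped Classical

noncomputable section

/-- For every direction some line of that direction passes through a given point, and
the other points on it are exactly those in that direction. -/
theorem exists_line_through {F : Type*} [Field F] (y : Option F) (P : F × F) :
    ∃ c : F, onLine y c P ∧ ∀ Q, onLine y c Q → Q ≠ P → direction Q P = y := by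
  obtain ⟨a, b⟩ := P
  cases y with
  | none =>
    refine ⟨a, rfl, ?_⟩
    rintro ⟨u, w⟩ h _
    simp only [onLine] at h
    simp [direction, h]
  | some m =>
    refine ⟨b - m * a, by simp [onLine], ?_⟩
    rintro ⟨u, w⟩ h hne
    simp only [onLine] at h
    have hu : u ≠ a := by
      rintro rfl
      apply hne
      rw [h]; simp
    have hu' : u - a ≠ 0 := sub_ne_zero.mpr hu
    simp only [direction, if_neg hu]
    congr 1
    rw [div_eq_iff hu', h]
    ring

/-- If `U ⊆ AG(2,q)` is nonempty with nonempty direction set `D`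
and `s = min_{y∈D} s(y) > 1`, then `(s - 1)·|D| ≤ |U| - 1`. -/
theorem upper_bound_on_number_of_directions
    {F : Type*} [Field F] [Fintype F] (p h : ℕ) (hp : p.Prime) (hh : 0 < h)
    (hcard : Fintype.card F = p ^ h) (U : Set (F × F)) (hU : U.Nonempty)
    (hD : (dirSet U).Nonempty) (hs : 1 < sMin U) :
    (sMin U - 1) * (dirSet U).ncard ≤ U.ncard - 1 := by
  obtain ⟨P, hP⟩ := hU
  set V : Finset (F × F) := U.toFinset.erase P with hV
  set D : Finset (Option F) := (dirSet U).toFinset with hDdef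
  have hVcard : V.card = U.ncard - 1 := by
    rw [hV, Finset.card_erase_of_mem (by simpa using hP), Set.ncard_eq_toFinset_card']
  have hDcard : D.card = (dirSet U).ncard := by
    rw [hDdef, Set.ncard_eq_toFinset_card']
  have hmap : ∀ Q ∈ V, direction Q P ∈ D := by
    intro Q hQ
    rw [hV, Finset.mem_erase, Set.mem_toFinset] at hQ
    rw [hDdef, Set.mem_toFinset]
    exact ⟨Q, hQ.2, P, hP, hQ.1, rfl⟩
  rw [← hVcard, ← hDcard,
    Finset.card_eq_sum_card_fiberwise (f := fun Q => direction Q P) (t := D) hmap,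
    mul_comm, ← smul_eq_mul]
  apply Finset.card_nsmul_le_sum
  intro y hy
  rw [hDdef, Set.mem_toFinset] at hy
  obtain ⟨c, hc, hQ⟩ := exists_line_through y P
  have h1 : sMin U ≤ sdir U y := Nat.sInf_le ⟨y, hy, rfl⟩
  have h2 : sdir U y ∣ lineCount U y c :=
    (Nat.gcd_dvd_right _ _).trans (Finset.gcd_dvd (Finset.mem_univ c))
  have h3 : 0 < lineCount U y c := by
    unfold lineCount
    rw [Set.ncard_pos]
    exact ⟨P, hP, hc⟩
  have h4 : sMin U ≤ lineCount U y c := h1.trans (Nat.le_of_dvd h3 h2)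
  have h5 : lineCount U y c - 1 = ({Q ∈ U | onLine y c Q}.toFinset.erase P).card := by
    rw [Finset.card_erase_of_mem (by simpa using ⟨hP, hc⟩), lineCount,
      Set.ncard_eq_toFinset_card']
  refine (Nat.sub_le_sub_right h4 1).trans ?_
  rw [h5]
  apply Finset.card_le_card
  intro Q hQm
  rw [Finset.mem_erase, Set.mem_toFinset] at hQm
  rw [Finset.mem_filter, hV, Finset.mem_erase, Set.mem_toFinset]
  exact ⟨⟨hQm.1, hQm.2.1⟩, hQ Q hQm.2.2 hQm.1⟩
end
end

section
/- Let F be a field of characteristic p > 0, let s = p^e and q = p^h with e ≤ h. Let g, f ∈ F[X] be nonzero polynomials such that g·f ∈ F[X^s] and deg f ≤ s − 1. Then the remainder X^q mod g lies in F[X^s], and g·(X^q div g) = X^q − (X^q mod g) lies in F[X^s]; that is, multiplying g by the quotient of X^q by g extends g to a polynomial in F[X^s]. -/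
open Polynomial

noncomputable section

theorem inXpow_expand {F : Type*} [Field F] (s : ℕ) (hs : 0 < s) (a : Polynomial F) :
    inXpow s (expand F s a) := by
  intro i hi
  rw [coeff_expand hs] at hi
  by_contra hc
  simp [hc] at hi

theorem expand_contract_of_inXpow {F : Type*} [Field F] (s : ℕ) (hs : 0 < s)
    (a : Polynomial F) (ha : inXpow s a) : expand F s (contract s a) = a := by
  ext i
  rw [coeff_expand hs]
  split_ifs with hd
  · rw [coeff_contract hs.ne', Nat.div_mul_cancel hd]
  · by_contra hc
    exact hd (ha i (Ne.symm hc))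

/-- Let `F` be a field of characteristic `p > 0`, `s = p^e`,
`q = p^h` with `e ≤ h`. If `g, f ∈ F[X]` are nonzero with `g·f ∈ F[X^s]` and
`deg f ≤ s - 1`, then `X^q mod g ∈ F[X^s]` and `g·(X^q div g) = X^q - (X^q mod g)`
lies in `F[X^s]`: multiplying by the quotient of `X^q` by `g` extends `g` to a
polynomial in `F[X^s]`. -/
theorem quotient_extends_to_subfield_polynomial
    {F : Type*} [Field F] (p e h : ℕ) [CharP F p] (hp : 0 < p) (heh : e ≤ h)
    (g f : Polynomial F) (hg : g ≠ 0) (hf : f ≠ 0)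
    (hgf : inXpow (p ^ e) (g * f)) (hdeg : f.natDegree ≤ p ^ e - 1) :
    inXpow (p ^ e) ((X : Polynomial F) ^ p ^ h % g) ∧
      inXpow (p ^ e) (g * ((X : Polynomial F) ^ p ^ h / g)) := by
  have hs : 0 < p ^ e := pow_pos hp e
  have hq : p ^ h = p ^ e * p ^ (h - e) := by rw [← pow_add]; congr 1; omega
  generalize p ^ (h - e) = m at hq
  generalize p ^ h = q at hq
  generalize p ^ e = s at *
  have hG := expand_contract_of_inXpow s hs _ hgf
  set G := contract s (g * f) with hGdef
  have hG0 : G ≠ 0 := by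
    intro h0
    rw [h0, map_zero] at hG
    exact mul_ne_zero hg hf hG.symm
  have hX : (X : Polynomial F) ^ q = expand F s (X ^ m) := by
    rw [map_pow, expand_X, ← pow_mul, hq]
  have hdiv : (X : Polynomial F) ^ q =
      g * (f * expand F s (X ^ m / G)) + expand F s (X ^ m % G) := by
    rw [← mul_assoc, ← hG, ← map_mul, ← map_add, EuclideanDomain.div_add_mod, hX]
  have hlt : (expand F s (X ^ m % G)).degree < g.degree := by
    by_cases hR : X ^ m % G = 0
    · rw [hR, map_zero, degree_zero]
      exact bot_lt_iff_ne_bot.mpr (by rwa [Ne, degree_eq_bot])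
    · have h1 : (X ^ m % G).natDegree < G.natDegree :=
        natDegree_lt_natDegree hR (EuclideanDomain.mod_lt _ hG0)
      refine degree_lt_degree ?_
      have h2 : G.natDegree * s = g.natDegree + f.natDegree := by
        rw [← natDegree_expand, hG, natDegree_mul hg hf]
      rw [natDegree_expand]
      have h3 : ((X ^ m % G).natDegree + 1) * s ≤ G.natDegree * s :=
        Nat.mul_le_mul_right _ h1
      rw [add_mul] at h3
      omega
  have hmod : (X : Polynomial F) ^ q % g = expand F s (X ^ m % G) := by
    rw [hdiv, Polynomial.add_mod, EuclideanDomain.mod_eq_zero.mpr (dvd_mul_right _ _), zero_add,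
      (Polynomial.mod_eq_self_iff hg).mpr hlt]
  refine ⟨hmod ▸ inXpow_expand s hs _, ?_⟩
  have hmul : g * ((X : Polynomial F) ^ q / g) = expand F s (X ^ m - X ^ m % G) := by
    rw [map_sub, ← hmod, ← hX]
    exact eq_sub_of_add_eq (EuclideanDomain.div_add_mod _ _)
  rw [hmul]
  exact inXpow_expand s hs _
end
end

section
/- Let F be a field of characteristic p > 0, let s = p^e and q = p^h with e ≤ h. Let g, f ∈ F[X] be nonzero polynomials such that g·f ∈ F[X^s] and deg f ≤ s − 1. Then the remainder of X^q upon division by g equals the remainder of X^q upon division by f·g, i.e. X^q mod g = X^q mod (f·g); consequently X^q div g = f·(X^q div (f·g)). -/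
open Polynomial

noncomputable section

theorem divmod_uniq_aux {F : Type*} [Field F] (a b q r : Polynomial F)
    (h : a = b * q + r) (hr : r.degree < b.degree) : a % b = r ∧ a / b = q := by
  have hb : b ≠ 0 := by
    rintro rfl
    simp at hr
  have h1 : a % b = r := by
    rw [h, Polynomial.add_mod, (Polynomial.mod_eq_self_iff hb).2 hr]
    simp
  refine ⟨h1, ?_⟩
  have h2 := EuclideanDomain.div_add_mod a b
  rw [h1] at h2
  have h3 : b * (a / b) = b * q := by
    apply add_right_cancel (b := r)
    rw [h2, ← h]
  exact mul_left_cancel₀ hb h3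

/-- Let `F` be a field of characteristic `p > 0`, `s = p^e`,
`q = p^h` with `e ≤ h`. If `g, f ∈ F[X]` are nonzero with `g·f ∈ F[X^s]` and
`deg f ≤ s - 1`, then `X^q mod g = X^q mod (f·g)`, and consequently
`X^q div g = f·(X^q div (f·g))`. -/
theorem mod_by_g_eq_mod_by_fg
    {F : Type*} [Field F] (p e h : ℕ) [CharP F p] (hp : 0 < p) (heh : e ≤ h)
    (g f : Polynomial F) (hg : g ≠ 0) (hf : f ≠ 0)
    (hgf : inXpow (p ^ e) (g * f)) (hdeg : f.natDegree ≤ p ^ e - 1) :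
    (X : Polynomial F) ^ p ^ h % g = (X : Polynomial F) ^ p ^ h % (f * g) ∧
      (X : Polynomial F) ^ p ^ h / g = f * ((X : Polynomial F) ^ p ^ h / (f * g)) := by
  have hs : 0 < p ^ e := pow_pos hp e
  have hq : p ^ h = p ^ e * p ^ (h - e) := by rw [← pow_add, Nat.add_sub_cancel' heh]
  generalize p ^ e = s at *
  generalize p ^ (h - e) = k at *
  rw [hq]
  obtain ⟨G, hG⟩ : ∃ G : Polynomial F, f * g = expand F s G := by
    refine ⟨contract s (g * f), ?_⟩
    ext n
    rw [coeff_expand hs, mul_comm f g]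
    split_ifs with hd
    · rw [coeff_contract hs.ne', Nat.div_mul_cancel hd]
    · by_contra hne
      exact hd (hgf n hne)
  have hfg : f * g ≠ 0 := mul_ne_zero hf hg
  have hG0 : G ≠ 0 := by
    rintro rfl
    simp at hG
    tauto
  have hnd : f.natDegree + g.natDegree = G.natDegree * s := by
    rw [← natDegree_mul hf hg, hG, natDegree_expand]
  have hX : (X : Polynomial F) ^ (s * k)
      = f * g * expand F s (X ^ k / G) + expand F s (X ^ k % G) := by
    rw [hG, ← map_mul, ← map_add, EuclideanDomain.div_add_mod, map_pow, expand_X, pow_mul]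
  have hdg : (expand F s (X ^ k % G)).degree < g.degree := by
    by_cases h0 : (X ^ k % G : Polynomial F) = 0
    · rw [h0, map_zero, degree_zero]
      exact bot_lt_iff_ne_bot.2 (degree_eq_bot.not.2 hg)
    · have h1 : (X ^ k % G : Polynomial F).natDegree < G.natDegree :=
        natDegree_lt_natDegree h0 (EuclideanDomain.mod_lt _ hG0)
      apply degree_lt_degree
      rw [natDegree_expand]
      have h2 := Nat.mul_le_mul_right s (Nat.succ_le_of_lt h1)
      rw [Nat.succ_mul] at h2
      omega
  have hle : g.degree ≤ (f * g).degree := degree_le_of_dvd (Dvd.intro_left f rfl) hfg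
  obtain ⟨a1, a2⟩ := divmod_uniq_aux _ _ _ _ hX (hdg.trans_le hle)
  obtain ⟨b1, b2⟩ := divmod_uniq_aux ((X : Polynomial F) ^ (s * k)) g
    (f * expand F s (X ^ k / G)) (expand F s (X ^ k % G)) (by rw [hX]; ring) hdg
  exact ⟨b1.trans a1.symm, by rw [b2, a2]⟩
end
end
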